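/- arXiv:1303.3053 — 3 statements merged into one kernel-verified Lean document; each statement's English description precedes it below -/
import Mathlib

section
/- Let A be a finite set of integers with |A| = k ≥ 3. If |A + 2∗A| < 4k − 4, then A is contained in an arithmetic progression of size at most |A + 2∗A| − 2k + 2, which is at most 2k − 3. -/
open Classical in
/-- The elements of a subgroup of a finite group, as a finset. -/
noncomputable def subF {G : Type} [AddCommGroup G] [Fintype G] (H : AddSubgroup G) : Finset G :=
  Finset.univ.filter (fun g => g ∈ H)

lemma mem_subF {G : Type} [AddCommGroup G] [Fintype G] (H : AddSubgroup G) (g : G) :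
    g ∈ subF H ↔ g ∈ H := by simp [subF]

/-- `C` is a union of cosets of `H`. -/
def Per {G : Type} [AddCommGroup G] (H : AddSubgroup G) (C : Finset G) : Prop :=
  ∀ h ∈ H, ∀ x ∈ C, h + x ∈ C

lemma per_dvd {G : Type} [AddCommGroup G] [Fintype G] [DecidableEq G] (H : AddSubgroup G)
    (C : Finset G) (hC : Per H C) : (subF H).card ∣ C.card := by
  classical
  rw [Finset.card_eq_sum_card_image (fun x => (QuotientAddGroup.mk x : G ⧸ H)) C]
  apply Finset.dvd_sum
  intro q hq
  obtain ⟨x, hx, rfl⟩ := Finset.mem_image.1 hq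
  apply dvd_of_eq
  apply Finset.card_bij (fun h _ => h + x)
  · intro h hh
    rw [mem_subF] at hh
    simp only [Finset.mem_filter]
    refine ⟨hC h hh x hx, ?_⟩
    rw [QuotientAddGroup.eq]
    have : -(h + x) + x = -h := by abel
    rw [this]; exact H.neg_mem hh
  · intro a _ b _ hab
    exact add_right_cancel hab
  · intro y hy
    simp only [Finset.mem_filter] at hy
    refine ⟨y - x, ?_, by abel⟩
    rw [mem_subF]
    have := QuotientAddGroup.eq.1 hy.2.symm
    rwa [neg_add_eq_sub] at this

lemma grid_bound {G : Type} [AddCommGroup G] [Fintype G] [DecidableEq G]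
    (C₁ C₂ : Finset G) (H₁ H₂ : AddSubgroup G) (h₁ : Per H₁ C₁) (h₂ : Per H₂ C₂) (d : G) :
    ((subF H₁).filter (fun h => d + h ∈ C₂)).card *
      ((subF H₂).card - ((subF H₂).filter (fun h => d + h ∈ C₁)).card) ≤
      (subF (H₁ ⊓ H₂)).card * (C₂ \ C₁).card := by
  classical
  have e : (subF H₂).card - ((subF H₂).filter (fun h => d + h ∈ C₁)).card
      = ((subF H₂).filter (fun h => ¬ d + h ∈ C₁)).card := by
    have := Finset.card_filter_add_card_filter_not (s := subF H₂) (fun h => d + h ∈ C₁)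
    omega
  rw [e, ← Finset.card_product]
  apply Finset.card_le_mul_card_image_of_maps_to (f := fun z : G × G => d + z.1 + z.2)
  · rintro ⟨a, b⟩ hab
    simp only [Finset.mem_product, Finset.mem_filter, mem_subF] at hab
    obtain ⟨⟨ha, ha'⟩, hb, hb'⟩ := hab
    simp only [Finset.mem_sdiff]
    refine ⟨?_, fun hc => hb' ?_⟩
    · have := h₂ b hb _ ha'
      rwa [add_comm b] at this
    · have := h₁ (-a) (H₁.neg_mem ha) _ hc
      have e2 : -a + (d + a + b) = d + b := by abel
      rwa [e2] at this
  · intro c hc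
    by_cases hne : ((Finset.filter (fun h => d + h ∈ C₂) (subF H₁) ×ˢ
      Finset.filter (fun h => ¬ d + h ∈ C₁) (subF H₂)).filter (fun z : G × G => d + z.1 + z.2 = c)).Nonempty
    · obtain ⟨⟨a, b⟩, hab⟩ := hne
      simp only [Finset.mem_product, Finset.mem_filter, mem_subF] at hab
      obtain ⟨⟨⟨ha, ha'⟩, hb, hb'⟩, hc'⟩ := hab
      apply Finset.card_le_card_of_injOn (fun z : G × G => z.1 - a)
      · rintro ⟨x, y⟩ hxy
        simp only [Finset.coe_filter, Set.mem_setOf_eq, Finset.mem_product, Finset.mem_filter, mem_subF] at hxy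
        obtain ⟨⟨⟨hx, hx'⟩, hy, hy'⟩, hxy'⟩ := hxy
        simp only [Finset.mem_coe, mem_subF, AddSubgroup.mem_inf]
        refine ⟨H₁.sub_mem hx ha, ?_⟩
        have e3 : x - a = b - y := by
          have : d + x + y = d + a + b := by rw [hxy', hc']
          have h5 : x + y = a + b := by
            rw [add_assoc, add_assoc] at this; exact add_left_cancel this
          rw [sub_eq_sub_iff_add_eq_add, h5, add_comm]
        rw [e3]; exact H₂.sub_mem hb hy
      · rintro ⟨x, y⟩ hxy ⟨x', y'⟩ hxy' hh
        simp only [Finset.coe_filter, Set.mem_setOf_eq] at hxy hxy'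
        have hx : x = x' := by simpa using hh
        subst hx
        have := hxy.2.trans hxy'.2.symm
        simpa using this
    · rw [Finset.not_nonempty_iff_eq_empty] at hne
      rw [hne]; simp

lemma arith_grid (u v p q m E₁ E₂ : ℕ) (hu : 1 ≤ u) (hu' : u < q) (hv : 1 ≤ v) (hv' : v < p)
    (h1 : u * (p - v) * m ≤ E₁) (h2 : v * (q - u) * m ≤ E₂) :
    p * m ≤ E₂ + m ∨ q * m ≤ E₁ + m := by
  by_contra! hcon
  obtain ⟨hc1, hc2⟩ := hcon
  have hs : p + q - 2 ≤ u * (p - v) + v * (q - u) := by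
    obtain ⟨u, rfl⟩ := Nat.exists_eq_add_of_le hu
    obtain ⟨v, rfl⟩ := Nat.exists_eq_add_of_le hv
    obtain ⟨p, rfl⟩ := Nat.exists_eq_add_of_lt hv'
    obtain ⟨q, rfl⟩ := Nat.exists_eq_add_of_lt hu'
    have e1 : 1 + v + p + 1 - (1 + v) = p + 1 := by omega
    have e2 : 1 + u + q + 1 - (1 + u) = q + 1 := by omega
    rw [e1, e2]
    have : 1 + v + p + 1 + (1 + u + q + 1) - 2 = v + p + u + q + 2 := by omega
    rw [this]; nlinarith [Nat.zero_le (u*p), Nat.zero_le (v*q)]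
  have h3 : (p + q - 2) * m ≤ E₁ + E₂ := by nlinarith
  have h4 : (p + q - 2) * m + 2 * m = p * m + q * m := by
    rw [← add_mul, ← add_mul]; congr 1; omega
  omega

lemma kneser_union {G : Type} [AddCommGroup G] [Fintype G] [DecidableEq G]
    (C₁ C₂ : Finset G) (H₁ H₂ : AddSubgroup G) (h₁ : Per H₁ C₁) (h₂ : Per H₂ C₂) (n : ℕ)
    (n1 : n ≤ C₁.card + (subF H₁).card) (n2 : n ≤ C₂.card + (subF H₂).card) :
    ∃ H : AddSubgroup G, Per H (C₁ ∪ C₂) ∧ n ≤ (C₁ ∪ C₂).card + (subF H).card := by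
  classical
  by_cases hA : C₂ ⊆ C₁
  · exact ⟨H₁, by rwa [Finset.union_eq_left.2 hA], by rwa [Finset.union_eq_left.2 hA]⟩
  by_cases hB : C₁ ⊆ C₂
  · exact ⟨H₂, by rwa [Finset.union_eq_right.2 hB], by rwa [Finset.union_eq_right.2 hB]⟩
  refine ⟨H₁ ⊓ H₂, ?_, ?_⟩
  · intro h hh x hx
    rw [AddSubgroup.mem_inf] at hh
    rw [Finset.mem_union] at hx ⊢
    exact hx.imp (h₁ h hh.1 x) (h₂ h hh.2 x)
  obtain ⟨d', hd2, hd1⟩ := Finset.not_subset.1 hA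
  obtain ⟨d, hd3, hd4⟩ := Finset.not_subset.1 hB
  have c1 : (C₁ ∪ C₂).card = C₁.card + (C₂ \ C₁).card := by
    have := Finset.card_sdiff_add_card C₂ C₁
    rw [Finset.union_comm] at this; omega
  have c2 : (C₁ ∪ C₂).card = C₂.card + (C₁ \ C₂).card := by
    have := Finset.card_sdiff_add_card C₁ C₂
    omega
  set m := (subF (H₁ ⊓ H₂)).card with hm
  have mpos : 0 < m := Finset.card_pos.2 ⟨0, by rw [mem_subF]; exact zero_mem _⟩
  have key : ∀ (H : AddSubgroup G) (C : Finset G), Per (H₁ ⊓ H₂) C → H₁ ⊓ H₂ ≤ H → ∀ x : G,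
      m ∣ ((subF H).filter (fun h => x + h ∈ C)).card := by
    intro H C hC hH x
    apply per_dvd
    intro h hh y hy
    simp only [Finset.mem_filter, mem_subF] at hy ⊢
    refine ⟨H.add_mem (hH hh) hy.1, ?_⟩
    have := hC h hh _ hy.2
    rwa [add_left_comm] at this
  have p1 : Per (H₁ ⊓ H₂) C₁ := fun h hh => h₁ h (AddSubgroup.mem_inf.1 hh).1
  have p2 : Per (H₁ ⊓ H₂) C₂ := fun h hh => h₂ h (AddSubgroup.mem_inf.1 hh).2
  have q1 : m ∣ (subF H₁).card := per_dvd _ _ (fun h hh x hx => by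
    rw [mem_subF] at *; exact H₁.add_mem (AddSubgroup.mem_inf.1 hh).1 hx)
  have q2 : m ∣ (subF H₂).card := per_dvd _ _ (fun h hh x hx => by
    rw [mem_subF] at *; exact H₂.add_mem (AddSubgroup.mem_inf.1 hh).2 hx)
  obtain ⟨p, hp⟩ := q1
  obtain ⟨q, hq⟩ := q2
  have main : ∀ x : G, ∃ u v : ℕ, u ≤ q ∧ v ≤ p ∧ u * (p - v) * m ≤ (C₁ \ C₂).card ∧
      v * (q - u) * m ≤ (C₂ \ C₁).card ∧ (x ∈ C₁ → 1 ≤ u) ∧ (x ∉ C₁ → u < q) ∧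
      (x ∈ C₂ → 1 ≤ v) ∧ (x ∉ C₂ → v < p) := by
    intro x
    obtain ⟨u, hu⟩ := key H₂ C₁ p1 inf_le_right x
    obtain ⟨v, hv⟩ := key H₁ C₂ p2 inf_le_left x
    have g1 := grid_bound C₁ C₂ H₁ H₂ h₁ h₂ x
    have g2 := grid_bound C₂ C₁ H₂ H₁ h₂ h₁ x
    rw [inf_comm, ← hm, hu, hv, hp, ← Nat.mul_sub, mul_assoc] at g2
    rw [← hm, hu, hv, hq, ← Nat.mul_sub, mul_assoc] at g1
    have g1' := Nat.le_of_mul_le_mul_left g1 mpos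
    have g2' := Nat.le_of_mul_le_mul_left g2 mpos
    have z1 : (0:G) ∈ subF H₁ := by rw [mem_subF]; exact zero_mem _
    have z2 : (0:G) ∈ subF H₂ := by rw [mem_subF]; exact zero_mem _
    have uq : u ≤ q := by
      have := Finset.card_filter_le (subF H₂) (fun h => x + h ∈ C₁)
      rw [hu, hq] at this
      exact Nat.le_of_mul_le_mul_left this mpos
    have vp : v ≤ p := by
      have := Finset.card_filter_le (subF H₁) (fun h => x + h ∈ C₂)
      rw [hv, hp] at this
      exact Nat.le_of_mul_le_mul_left this mpos
    refine ⟨u, v, uq, vp, by nlinarith, by nlinarith, ?_, ?_, ?_, ?_⟩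
    · intro hx
      by_contra hc
      have : u = 0 := by omega
      rw [this, mul_zero, Finset.card_eq_zero] at hu
      have : (0:G) ∈ (subF H₂).filter (fun h => x + h ∈ C₁) := by simp [z2, hx]
      rw [hu] at this; simp at this
    · intro hx
      apply lt_of_le_of_ne uq
      rintro rfl
      have := Finset.filter_card_eq (hu.trans hq.symm) 0 z2
      simp [hx] at this
    · intro hx
      by_contra hc
      have : v = 0 := by omega
      rw [this, mul_zero, Finset.card_eq_zero] at hv
      have : (0:G) ∈ (subF H₁).filter (fun h => x + h ∈ C₂) := by simp [z1, hx]
      rw [hv] at this; simp at this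
    · intro hx
      apply lt_of_le_of_ne vp
      rintro rfl
      have := Finset.filter_card_eq (hv.trans hp.symm) 0 z1
      simp [hx] at this
  suffices hgoal : p * m ≤ (C₂ \ C₁).card + m ∨ q * m ≤ (C₁ \ C₂).card + m by
    rw [hp, mul_comm] at n1
    rw [hq, mul_comm] at n2
    rcases hgoal with h | h <;> omega
  obtain ⟨u, v, uq, vp, b1, b2, i1, -, -, i2⟩ := main d
  obtain ⟨u', v', uq', vp', b1', b2', -, i3, i4, -⟩ := main d'
  have i1 := i1 hd3
  have i2 := i2 hd4
  have i3 := i3 hd1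
  have i4 := i4 hd2
  generalize (C₁ \ C₂).card = E₁ at *
  generalize (C₂ \ C₁).card = E₂ at *
  rcases Nat.eq_zero_or_pos v with hv | hv
  swap
  · rcases Nat.lt_or_ge u q with hu | hu
    · exact arith_grid u v p q m E₁ E₂ i1 hu hv i2 b1 b2
    · right
      have : u = q := by omega
      subst this
      have : u * 1 * m ≤ u * (p - v) * m := by gcongr; omega
      rw [mul_one] at this
      omega
  rcases Nat.eq_zero_or_pos u' with hu | hu
  swap
  · rcases Nat.lt_or_ge v' p with hv' | hv'
    · exact arith_grid u' v' p q m E₁ E₂ hu i3 i4 hv' b1' b2'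
    · left
      have : v' = p := by omega
      subst this
      have : v' * 1 * m ≤ v' * (q - u') * m := by gcongr; omega
      rw [mul_one] at this
      omega
  subst hv hu
  have f1 : 1 * (p - 0) * m ≤ u * (p - 0) * m := by gcongr
  have f2 : 1 * (q - 0) * m ≤ v' * (q - 0) * m := by gcongr
  simp only [Nat.sub_zero, one_mul] at f1 f2 b1 b2'
  rcases le_total p q with h | h
  · left
    have := Nat.mul_le_mul_right m h
    omega
  · right
    have := Nat.mul_le_mul_right m h
    omega

/-- The stabilizer of a finite set. -/
def stabF {G : Type} [AddCommGroup G] (C : Finset G) : AddSubgroup G where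
  carrier := {g | ∀ x, g + x ∈ C ↔ x ∈ C}
  zero_mem' := by intro x; simp
  add_mem' := by
    intro a b ha hb x
    rw [add_assoc, ha, hb]
  neg_mem' := by
    intro a ha x
    rw [← ha (-a + x)]; simp

lemma mem_stabF {G : Type} [AddCommGroup G] [DecidableEq G] (C : Finset G) (g : G)
    (h : ∀ x ∈ C, g + x ∈ C) : g ∈ stabF C := by
  have hi : C.image (fun x => g + x) = C := by
    apply Finset.eq_of_subset_of_card_le
    · intro y hy
      obtain ⟨x, hx, rfl⟩ := Finset.mem_image.1 hy
      exact h x hx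
    · rw [Finset.card_image_of_injective _ (add_right_injective g)]
  intro x
  refine ⟨fun hx => ?_, h x⟩
  rw [← hi] at hx
  obtain ⟨y, hy, hxy⟩ := Finset.mem_image.1 hx
  rwa [← add_left_cancel hxy]

lemma stabF_per {G : Type} [AddCommGroup G] (C : Finset G) : Per (stabF C) C :=
  fun _ hh x hx => (hh x).2 hx

lemma per_le_stabF {G : Type} [AddCommGroup G] [DecidableEq G] (C : Finset G) (H : AddSubgroup G)
    (h : Per H C) : H ≤ stabF C := fun g hg => mem_stabF C g (h g hg)

open scoped Pointwise in
lemma kneser_point {G : Type} [AddCommGroup G] [Fintype G] [DecidableEq G] (n : ℕ) :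
    ∀ (A B : Finset G), B.card ≤ n → ∀ a ∈ A, ∀ b ∈ B, ∃ (C : Finset G) (H : AddSubgroup G),
      a + b ∈ C ∧ C ⊆ A + B ∧ Per H C ∧ A.card + B.card ≤ C.card + (subF H).card := by
  induction n with
  | zero =>
    intro A B hB a _ b hb
    have : B = ∅ := by simpa using hB
    simp [this] at hb
  | succ n ih =>
    intro A B hB a ha b hb
    by_cases hall : ∀ x ∈ A, ∀ y ∈ B, (y - b) + x ∈ A
    · refine ⟨A.image (fun x => x + b), stabF A, Finset.mem_image_of_mem _ ha, ?_, ?_, ?_⟩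
      · intro z hz
        obtain ⟨x, hx, rfl⟩ := Finset.mem_image.1 hz
        exact Finset.add_mem_add hx hb
      · intro h hh z hz
        obtain ⟨x, hx, rfl⟩ := Finset.mem_image.1 hz
        rw [← add_assoc]
        exact Finset.mem_image_of_mem _ (stabF_per A h hh x hx)
      · rw [Finset.card_image_of_injective _ (add_left_injective b)]
        apply Nat.add_le_add_left
        apply Finset.card_le_card_of_injOn (fun y => y - b)
        · intro y hy
          rw [Finset.mem_coe, mem_subF]
          exact mem_stabF A _ (fun x hx => hall x hx y hy)
        · intro y _ z _ hyz
          simpa using hyz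
    · push Not at hall
      obtain ⟨x, hx, y, hy, hxy⟩ := hall
      set e := x - b with he
      set Be := B.image (fun z => e + z) with hBe
      set A' := A ∪ Be with hA'
      set B' := (A ∩ Be).image (fun z => -e + z) with hB'
      have cc : A'.card + B'.card = A.card + B.card := by
        rw [hB', Finset.card_image_of_injective _ (add_right_injective _), hA',
          Finset.card_union_add_card_inter, hBe,
          Finset.card_image_of_injective _ (add_right_injective _)]
      have memB' : ∀ z, z ∈ B' ↔ z ∈ B ∧ e + z ∈ A := by
        intro z
        simp only [hB', hBe, Finset.mem_image, Finset.mem_inter]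
        constructor
        · rintro ⟨_, ⟨h1, w, hw, rfl⟩, rfl⟩
          simp [hw, h1]
        · rintro ⟨h1, h2⟩
          exact ⟨e + z, ⟨h2, z, h1, rfl⟩, by simp⟩
      have hlt : B'.card < B.card := by
        apply Finset.card_lt_card
        refine (Finset.ssubset_iff_of_subset (fun z hz => ((memB' z).1 hz).1)).2 ⟨y, hy, ?_⟩
        rw [memB']
        rintro ⟨-, h2⟩
        apply hxy
        have : y - b + x = e + y := by rw [he]; abel
        rwa [this]
      obtain ⟨C, H, h1, h2, h3, h4⟩ := ih A' B' (by omega) a (Finset.mem_union_left _ ha) b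
        ((memB' b).2 ⟨hb, by rw [he]; simpa using hx⟩)
      refine ⟨C, H, h1, h2.trans ?_, h3, by omega⟩
      intro z hz
      obtain ⟨s, hs, t, ht, rfl⟩ := Finset.mem_add.1 hz
      rw [memB'] at ht
      rcases Finset.mem_union.1 hs with hs | hs
      · exact Finset.add_mem_add hs ht.1
      · obtain ⟨w, hw, rfl⟩ := Finset.mem_image.1 hs
        have : e + w + t = (e + t) + w := by abel
        rw [this]
        exact Finset.add_mem_add ht.2 hw

open scoped Pointwise in
lemma kneser {G : Type} [AddCommGroup G] [Fintype G] [DecidableEq G] (A B : Finset G)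
    (hA : A.Nonempty) (hB : B.Nonempty) : ∃ H : AddSubgroup G, Per H (A + B) ∧
      A.card + B.card ≤ (A + B).card + (subF H).card := by
  have key : ∀ T : Finset G, T ⊆ A + B → ∃ (C : Finset G) (H : AddSubgroup G),
      T ⊆ C ∧ C ⊆ A + B ∧ Per H C ∧ A.card + B.card ≤ C.card + (subF H).card := by
    intro T
    induction T using Finset.induction_on with
    | empty =>
      intro _
      obtain ⟨a, ha⟩ := hA
      obtain ⟨b, hb⟩ := hB
      obtain ⟨C, H, -, h2⟩ := kneser_point B.card A B le_rfl a ha b hb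
      exact ⟨C, H, by simp, h2⟩
    | insert t T _ ih =>
      intro hT
      obtain ⟨C₁, H₁, h1, h2, h3, h4⟩ := ih (fun x hx => hT (Finset.mem_insert_of_mem hx))
      obtain ⟨a, ha, b, hb, hab⟩ := Finset.mem_add.1 (hT (Finset.mem_insert_self _ _))
      obtain ⟨C₂, H₂, k1, k2, k3, k4⟩ := kneser_point B.card A B le_rfl a ha b hb
      obtain ⟨H, hH, hc⟩ := kneser_union C₁ C₂ H₁ H₂ h3 k3 _ h4 k4
      refine ⟨C₁ ∪ C₂, H, ?_, Finset.union_subset h2 k2, hH, hc⟩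
      intro x hx
      rcases Finset.mem_insert.1 hx with rfl | hx
      · rw [← hab]; exact Finset.mem_union_right _ k1
      · exact Finset.mem_union_left _ (h1 hx)
  obtain ⟨C, H, h1, h2, h3, h4⟩ := key (A + B) subset_rfl
  have : C = A + B := h2.antisymm h1
  subst this
  exact ⟨H, h3, h4⟩

open scoped Pointwise in
/-- Kneser's theorem, in the form with the exact stabilizer. -/
lemma kneser_stab {G : Type} [AddCommGroup G] [Fintype G] [DecidableEq G] (A B : Finset G)
    (hA : A.Nonempty) (hB : B.Nonempty) :
    (A + subF (stabF (A + B))).card + (B + subF (stabF (A + B))).card ≤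
      (A + B).card + (subF (stabF (A + B))).card := by
  set H := stabF (A + B) with hH
  have z : (0 : G) ∈ subF H := by rw [mem_subF]; exact zero_mem _
  have e : (A + subF H) + (B + subF H) = A + B := by
    ext x
    constructor
    · intro hx
      obtain ⟨s, hs, t, ht, rfl⟩ := Finset.mem_add.1 hx
      obtain ⟨a, ha, h, hh, rfl⟩ := Finset.mem_add.1 hs
      obtain ⟨b, hb, h', hh', rfl⟩ := Finset.mem_add.1 ht
      rw [mem_subF] at hh hh'
      have : a + h + (b + h') = (h + h') + (a + b) := by abel
      rw [this]
      exact stabF_per (A + B) _ (H.add_mem hh hh') _ (Finset.add_mem_add ha hb)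
    · intro hx
      obtain ⟨a, ha, b, hb, rfl⟩ := Finset.mem_add.1 hx
      refine Finset.add_mem_add ?_ ?_
      · simpa using Finset.add_mem_add ha z
      · simpa using Finset.add_mem_add hb z
  obtain ⟨K, hK, hc⟩ := kneser (A + subF H) (B + subF H) (hA.add ⟨0, z⟩) (hB.add ⟨0, z⟩)
  rw [e] at hK hc
  refine hc.trans ?_
  gcongr
  intro g hg
  rw [mem_subF] at hg ⊢
  exact per_le_stabF _ _ hK hg

open scoped Pointwise in
lemma two_set (A B : Finset ℤ) (l : ℕ) (hl0 : 0 < l) (h0 : 0 ∈ A) (hl : (l : ℤ) ∈ A)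
    (hr : ∀ a ∈ A, 0 ≤ a ∧ a ≤ l)
    (hgen : ∀ K : AddSubgroup ℤ, (∀ a ∈ A, a ∈ K) → (1 : ℤ) ∈ K)
    (hB : B.Nonempty) (hBl : ∀ b ∈ B, ∀ b' ∈ B, b - b' < l) :
    l + B.card ≤ (A + B).card ∨ A.card + 2 * B.card ≤ (A + B).card + 2 := by
  classical
  haveI : NeZero l := ⟨hl0.ne'⟩
  have sep : ∀ x y : ℤ, (x : ZMod l) = (y : ZMod l) → x - y < l → y - x < l → x = y := by
    intro x y hxy h1 h2
    rw [ZMod.intCast_eq_intCast_iff_dvd_sub] at hxy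
    have := Int.eq_zero_of_abs_lt_dvd hxy (abs_lt.2 ⟨by omega, by omega⟩)
    omega
  set φ : ℤ → ZMod l := fun x => (x : ZMod l) with hφ
  have φadd : ∀ x y, φ (x + y) = φ x + φ y := fun x y => Int.cast_add x y
  have φl : φ l = 0 := by simp [hφ]
  have φ0 : φ 0 = 0 := by simp [hφ]
  set A' := A.erase (l : ℤ) with hA'
  set Ab := A'.image φ with hAb
  set Bb := B.image φ with hBb
  have injA : Set.InjOn φ A' := by
    intro x hx y hy hxy
    simp only [hA', Finset.coe_erase, Set.mem_diff, Finset.mem_coe, Set.mem_singleton_iff] at hx hy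
    have := hr x hx.1
    have := hr y hy.1
    exact sep x y hxy (by omega) (by omega)
  have injB : Set.InjOn φ B := by
    intro x hx y hy hxy
    exact sep x y hxy (hBl x hx y hy) (hBl y hy x hx)
  have cA : Ab.card + 1 = A.card := by
    rw [hAb, Finset.card_image_of_injOn injA, hA', Finset.card_erase_add_one hl]
  have cB : Bb.card = B.card := Finset.card_image_of_injOn injB
  have zA' : (0 : ℤ) ∈ A' := Finset.mem_erase.2 ⟨by omega, h0⟩
  have memA : ∀ a ∈ A, φ a ∈ Ab := by
    intro a ha
    by_cases h : a = l
    · rw [h, φl, ← φ0]; exact Finset.mem_image_of_mem _ zA'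
    · exact Finset.mem_image_of_mem _ (Finset.mem_erase.2 ⟨h, ha⟩)
  have memB : ∀ b ∈ B, φ b ∈ Bb := fun b hb => Finset.mem_image_of_mem _ hb
  have neA : Ab.Nonempty := ⟨_, memA 0 h0⟩
  have neB : Bb.Nonempty := hB.image _
  set C := Ab + Bb with hC
  -- the counting estimate away from `E`
  have count : ∀ E : Finset (ZMod l), (∀ b ∈ B, φ b ∉ E) →
      (C \ E).card + B.card ≤ ((A + B).filter (fun s => φ s ∉ E)).card := by
    intro E hE
    set S₁ := (A + B).filter (fun s => φ s ∉ E) with hS₁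
    set Bl := B.image (fun b => b + (l : ℤ)) with hBl'
    have cBl : Bl.card = B.card := Finset.card_image_of_injective _ (add_left_injective _)
    have sub : Bl ⊆ S₁ := by
      intro x hx
      obtain ⟨b, hb, rfl⟩ := Finset.mem_image.1 hx
      rw [hS₁, Finset.mem_filter]
      refine ⟨?_, ?_⟩
      · rw [add_comm b]; exact Finset.add_mem_add hl hb
      · rw [φadd, φl, add_zero]; exact hE b hb
    have sub2 : C \ E ⊆ (S₁ \ Bl).image φ := by
      intro c hc
      rw [Finset.mem_sdiff] at hc
      by_cases hcB : c ∈ Bb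
      · obtain ⟨b, hb, rfl⟩ := Finset.mem_image.1 hcB
        refine Finset.mem_image_of_mem _ ?_
        rw [Finset.mem_sdiff, hS₁, Finset.mem_filter]
        refine ⟨⟨?_, hc.2⟩, ?_⟩
        · simpa using Finset.add_mem_add h0 hb
        · intro hb'
          obtain ⟨b', hb', hbb⟩ := Finset.mem_image.1 hb'
          have := hBl b hb b' hb'
          omega
      · obtain ⟨x, hx, y, hy, rfl⟩ := Finset.mem_add.1 hc.1
        obtain ⟨a, ha, rfl⟩ := Finset.mem_image.1 hx
        obtain ⟨b, hb, rfl⟩ := Finset.mem_image.1 hy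
        rw [← φadd] at hc hcB ⊢
        refine Finset.mem_image_of_mem _ ?_
        rw [Finset.mem_sdiff, hS₁, Finset.mem_filter]
        refine ⟨⟨Finset.add_mem_add (Finset.mem_of_mem_erase ha) hb, hc.2⟩, ?_⟩
        intro hb'
        obtain ⟨b', hb', hbb⟩ := Finset.mem_image.1 hb'
        apply hcB
        rw [← hbb, φadd, φl, add_zero]
        exact memB b' hb'
    have h1 := (Finset.card_le_card sub2).trans Finset.card_image_le
    have h2 := Finset.card_sdiff_add_card_eq_card sub
    omega
  have cnt0 := count ∅ (by simp)
  simp only [Finset.sdiff_empty, Finset.notMem_empty, not_false_eq_true, Finset.filter_true] at cnt0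
  by_cases hbig : Ab.card + Bb.card ≤ C.card + 1
  · right; omega
  have kn := kneser_stab Ab Bb neA neB
  rw [← hC] at kn
  set H := stabF C with hH
  by_cases htop : ∀ a ∈ A, φ a ∈ H
  · left
    have h1 : (1 : ℤ) ∈ H.comap (Int.castAddHom (ZMod l)) := hgen _ (fun a ha => htop a ha)
    have hall : ∀ z : ZMod l, z ∈ H := by
      intro z
      obtain ⟨n, rfl⟩ := ZMod.intCast_surjective z
      have : n • (1 : ℤ) ∈ H.comap (Int.castAddHom (ZMod l)) := zsmul_mem h1 n
      simpa using this
    have : C = Finset.univ := by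
      obtain ⟨c, hc⟩ := neA.add neB
      rw [← hC] at hc
      ext z
      simp only [Finset.mem_univ, iff_true]
      have := stabF_per C (z - c) (hall _) c hc
      simpa using this
    rw [this, Finset.card_univ, ZMod.card] at cnt0
    exact cnt0
  · right
    push Not at htop
    obtain ⟨a₁, ha₁, hna₁⟩ := htop
    set BH := Bb + subF H with hBH
    set AH := Ab + subF H with hAH
    have z : (0 : ZMod l) ∈ subF H := by rw [mem_subF]; exact zero_mem _
    have perBH : ∀ x ∈ BH, ∀ h ∈ H, x + h ∈ BH := by
      intro x hx h hh
      obtain ⟨b, hb, g, hg, rfl⟩ := Finset.mem_add.1 hx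
      rw [add_assoc]
      refine Finset.add_mem_add hb ?_
      rw [mem_subF] at hg ⊢
      exact H.add_mem hg hh
    have BHC : BH ⊆ C := by
      intro x hx
      obtain ⟨b, hb, g, hg, rfl⟩ := Finset.mem_add.1 hx
      rw [mem_subF] at hg
      rw [add_comm]
      refine stabF_per C g hg b ?_
      have := Finset.add_mem_add (memA 0 h0) hb
      rwa [φ0, zero_add] at this
    have hex : ∃ a ∈ A, ∃ b ∈ B, φ a + φ b ∉ BH := by
      by_contra! hcon
      apply hna₁
      apply mem_stabF
      have CBH : C ⊆ BH := by
        intro x hx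
        obtain ⟨s, hs, t, ht, rfl⟩ := Finset.mem_add.1 hx
        obtain ⟨a, ha, rfl⟩ := Finset.mem_image.1 hs
        obtain ⟨b, hb, rfl⟩ := Finset.mem_image.1 ht
        exact hcon a (Finset.mem_of_mem_erase ha) b hb
      intro x hx
      obtain ⟨s, hs, t, ht, rfl⟩ := Finset.mem_add.1 (CBH hx)
      obtain ⟨b, hb, rfl⟩ := Finset.mem_image.1 hs
      rw [mem_subF] at ht
      rw [← add_assoc]
      exact BHC (perBH _ (hcon a₁ ha₁ b hb) _ ht)
    obtain ⟨a, ha, b, hb, hab⟩ := hex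
    have BbBH : ∀ b ∈ B, φ b ∈ BH := by
      intro b hb
      simpa using Finset.add_mem_add (memB b hb) z
    set E := (subF H).image (fun h => φ a + φ b + h) with hE
    have cE : E.card = (subF H).card := Finset.card_image_of_injective _ (add_right_injective _)
    have memE : ∀ x, x ∈ E ↔ x - (φ a + φ b) ∈ H := by
      intro x
      rw [hE, Finset.mem_image]
      constructor
      · rintro ⟨h, hh, rfl⟩
        rw [mem_subF] at hh
        simpa using hh
      · intro h
        exact ⟨_, (mem_subF _ _).2 h, by abel⟩
    have EB : ∀ b ∈ B, φ b ∉ E := by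
      intro b' hb' hbE
      rw [memE] at hbE
      apply hab
      have := perBH _ (BbBH b' hb') _ (H.neg_mem hbE)
      simpa using this
    have cnt := count E EB
    have EC : E ⊆ C := by
      intro x hx
      rw [memE] at hx
      have := stabF_per C _ hx _ (Finset.add_mem_add (memA a ha) (memB b hb))
      simpa using this
    have cCE := Finset.card_sdiff_add_card_eq_card EC
    have haH : φ a ∉ H := by
      intro h
      apply hab
      rw [add_comm]
      exact perBH _ (BbBH b hb) _ h
    set Aa := A'.filter (fun x => φ x - φ a ∈ H) with hAa
    set Ba := B.filter (fun x => φ x - φ b ∈ H) with hBa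
    have Aane : Aa.Nonempty := by
      refine ⟨a, ?_⟩
      rw [hAa, Finset.mem_filter, Finset.mem_erase]
      refine ⟨⟨?_, ha⟩, by simp [zero_mem]⟩
      rintro rfl
      rw [φl] at haH
      exact haH (zero_mem _)
    have Bane : Ba.Nonempty := ⟨b, by rw [hBa, Finset.mem_filter]; exact ⟨hb, by simp [zero_mem]⟩⟩
    have cd := cauchy_davenport_add_of_linearOrder_isCancelAdd Aane Bane
    have S2 : Aa + Ba ⊆ (A + B).filter (fun s => ¬ φ s ∉ E) := by
      intro x hx
      obtain ⟨s, hs, t, ht, rfl⟩ := Finset.mem_add.1 hx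
      rw [hAa, Finset.mem_filter] at hs
      rw [hBa, Finset.mem_filter] at ht
      rw [Finset.mem_filter, not_not, memE, φadd]
      refine ⟨Finset.add_mem_add (Finset.mem_of_mem_erase hs.1) ht.1, ?_⟩
      have : φ s + φ t - (φ a + φ b) = (φ s - φ a) + (φ t - φ b) := by abel
      rw [this]
      exact H.add_mem hs.2 ht.2
    have cS2 := Finset.card_le_card S2
    have tot := Finset.card_filter_add_card_filter_not (s := A + B) (fun s => φ s ∉ E)
    -- the coset deficiency bound
    have defi : ∀ (X : Finset ℤ) (x₀ : ℤ), x₀ ∈ X → Set.InjOn φ X →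
        (X.image φ).card + (subF H).card ≤
          (X.image φ + subF H).card + (X.filter (fun x => φ x - φ x₀ ∈ H)).card := by
      intro X x₀ hx₀ inj
      set F := (subF H).image (fun h => φ x₀ + h) with hF
      have cF : F.card = (subF H).card := Finset.card_image_of_injective _ (add_right_injective _)
      rw [← cF, ← Finset.card_union_add_card_inter]
      apply Nat.add_le_add
      · apply Finset.card_le_card
        apply Finset.union_subset
        · intro y hy
          simpa using Finset.add_mem_add hy z
        · intro y hy
          obtain ⟨h, hh, rfl⟩ := Finset.mem_image.1 hy
          exact Finset.add_mem_add (Finset.mem_image_of_mem _ hx₀) hh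
      · refine le_trans (Finset.card_le_card ?_) (Finset.card_image_le (f := φ))
        intro y hy
        rw [Finset.mem_inter] at hy
        obtain ⟨h, hh, hy2⟩ := Finset.mem_image.1 hy.2
        obtain ⟨x, hx, rfl⟩ := Finset.mem_image.1 hy.1
        refine Finset.mem_image_of_mem _ ?_
        rw [Finset.mem_filter]
        rw [mem_subF] at hh
        exact ⟨hx, by rw [← hy2]; simpa using hh⟩
    have dA := defi A' a (by
      refine Finset.mem_erase.2 ⟨?_, ha⟩
      rintro rfl
      rw [φl] at haH
      exact haH (zero_mem _)) injA
    have dB := defi B b hb injB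
    rw [← hAb, ← hAH, ← hAa] at dA
    rw [← hBb, ← hBH, ← hBa] at dB
    have p1 := Aane.card_pos
    have p2 := Bane.card_pos
    omega

open scoped Pointwise in
lemma normalized (A : Finset ℤ) (l : ℕ) (hl0 : 0 < l) (h0 : 0 ∈ A) (hl : (l : ℤ) ∈ A)
    (hr : ∀ a ∈ A, 0 ≤ a ∧ a ≤ l)
    (hgen : ∀ K : AddSubgroup ℤ, (∀ a ∈ A, a ∈ K) → (1 : ℤ) ∈ K)
    (h : (Finset.image₂ (fun a b => a + 2 * b) A A).card + 4 < 4 * A.card) :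
    l + 2 * A.card ≤ (Finset.image₂ (fun a b => a + 2 * b) A A).card + 1 := by
  classical
  set S := Finset.image₂ (fun a b => a + 2 * b) A A with hS
  set B : ℤ → Finset ℤ := fun r => (A.filter (fun a => a % 2 = r)).image (fun a => a / 2) with hB
  have cB : ∀ r, (B r).card = (A.filter (fun a => a % 2 = r)).card := by
    intro r
    apply Finset.card_image_of_injOn
    intro x hx y hy hxy
    simp only [Finset.coe_filter, Set.mem_setOf_eq] at hx hy
    simp only at hxy
    omega
  have hk : A.card = (B 0).card + (B 1).card := by
    rw [cB, cB, ← Finset.card_filter_add_card_filter_not (s := A) (fun a => a % 2 = 0)]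
    congr 2
    apply Finset.filter_congr
    intro x _
    omega
  have hSr : ∀ r, (A + B r).card ≤ (S.filter (fun s => s % 2 = r)).card := by
    intro r
    apply Finset.card_le_card_of_injOn (fun x => 2 * x + r)
    · intro x hx
      obtain ⟨a, ha, y, hy, rfl⟩ := Finset.mem_add.1 hx
      obtain ⟨c, hc, rfl⟩ := Finset.mem_image.1 hy
      rw [Finset.mem_filter] at hc
      simp only [Finset.coe_filter, Set.mem_setOf_eq]
      refine ⟨?_, by omega⟩
      have : 2 * (a + c / 2) + r = c + 2 * a := by omega
      rw [this]
      exact Finset.mem_image₂_of_mem hc.1 ha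
    · intro x _ y _ hxy
      simp only at hxy
      omega
  have hSc : (A + B 0).card + (A + B 1).card ≤ S.card := by
    have h1 := hSr 0
    have h2 := hSr 1
    have h3 := Finset.card_filter_add_card_filter_not (s := S) (fun a => a % 2 = 0)
    have h4 : (S.filter (fun a => ¬ a % 2 = 0)) = S.filter (fun s => s % 2 = 1) := by
      apply Finset.filter_congr
      intro x _
      omega
    rw [h4] at h3
    omega
  have hBlen : ∀ r, ∀ b ∈ B r, ∀ b' ∈ B r, b - b' < l := by
    intro r b hb b' hb'
    obtain ⟨c, hc, rfl⟩ := Finset.mem_image.1 hb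
    obtain ⟨c', hc', rfl⟩ := Finset.mem_image.1 hb'
    have := hr c (Finset.mem_filter.1 hc).1
    have := hr c' (Finset.mem_filter.1 hc').1
    omega
  have ne0 : (B 0).Nonempty := ⟨0, Finset.mem_image.2 ⟨0, by simp [h0], by simp⟩⟩
  have ne1 : (B 1).Nonempty := by
    by_contra hcon
    rw [Finset.not_nonempty_iff_eq_empty] at hcon
    have := hgen (AddSubgroup.zmultiples 2) (by
      intro a ha
      rw [Int.mem_zmultiples_iff]
      by_contra hodd
      have : a / 2 ∈ B 1 := Finset.mem_image.2 ⟨a, Finset.mem_filter.2 ⟨ha, by omega⟩, rfl⟩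
      rw [hcon] at this
      simp at this)
    rw [Int.mem_zmultiples_iff] at this
    omega
  have t0 := two_set A (B 0) l hl0 h0 hl hr hgen ne0 (hBlen 0)
  have t1 := two_set A (B 1) l hl0 h0 hl hr hgen ne1 (hBlen 1)
  have hlk : A.card ≤ l + 1 := by
    have : A ⊆ Finset.Icc (0 : ℤ) l := fun a ha => Finset.mem_Icc.2 (hr a ha)
    have := Finset.card_le_card this
    simp at this
    omega
  have p0 := ne0.card_pos
  have p1 := ne1.card_pos
  omega

theorem stmt1 (A : Finset ℤ) (k : ℕ) (hk : A.card = k) (hk3 : 3 ≤ k)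
    (h : ((Finset.image₂ (fun a b => a + 2 * b) A A).card : ℤ) < 4 * k - 4) :
    ∃ (u d : ℤ) (l : ℕ),
      A ⊆ (Finset.range l).image (fun i : ℕ => u + (i : ℤ) * d) ∧
      (l : ℤ) ≤ ((Finset.image₂ (fun a b => a + 2 * b) A A).card : ℤ) - 2 * k + 2 ∧
      ((Finset.image₂ (fun a b => a + 2 * b) A A).card : ℤ) - 2 * k + 2 ≤ 2 * k - 3 := by
  classical
  have hne : A.Nonempty := Finset.card_pos.1 (by omega)
  set u := A.min' hne with hu
  have hu' : u ∈ A := A.min'_mem hne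
  have humin : ∀ a ∈ A, u ≤ a := fun a ha => A.min'_le a ha
  set D : AddSubgroup ℤ := AddSubgroup.closure ((fun a => a - u) '' (A : Set ℤ)) with hD
  obtain ⟨d₀, hd₀⟩ := Int.subgroup_cyclic D
  have hmemD : ∀ n, n ∈ D ↔ d₀ ∣ n := by
    intro n
    rw [hd₀, ← AddSubgroup.zmultiples_eq_closure, Int.mem_zmultiples_iff]
  set d := |d₀| with hd
  have hdvd : ∀ a ∈ A, d ∣ a - u := by
    intro a ha
    rw [hd, abs_dvd, ← hmemD]
    exact AddSubgroup.subset_closure ⟨a, ha, rfl⟩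
  have hdpos : 0 < d := by
    rw [hd, abs_pos]
    rintro hz
    have : A ⊆ {u} := by
      intro a ha
      have := hdvd a ha
      rw [hd, hz] at this
      simp at this
      simp; omega
    have := Finset.card_le_card this
    simp at this
    omega
  set f : ℤ → ℤ := fun a => (a - u) / d with hf
  have hfa : ∀ a ∈ A, a = u + f a * d := by
    intro a ha
    have := Int.ediv_mul_cancel (hdvd a ha)
    simp only [hf]
    omega
  set A' := A.image f with hA'
  have hAA : A = A'.image (fun x => u + x * d) := by
    rw [hA', Finset.image_image]
    ext x
    simp only [Finset.mem_image, Function.comp]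
    constructor
    · intro hx; exact ⟨x, hx, (hfa x hx).symm⟩
    · rintro ⟨y, hy, rfl⟩; rwa [← hfa y hy]
  have hinj : Function.Injective (fun x : ℤ => u + x * d) := by
    intro x y hxy
    simp only [add_right_inj] at hxy
    exact mul_right_cancel₀ hdpos.ne' hxy
  have cA' : A'.card = k := by
    rw [← hk, hAA, Finset.card_image_of_injective _ hinj]
  have cS : (Finset.image₂ (fun a b => a + 2 * b) A A).card
      = (Finset.image₂ (fun a b => a + 2 * b) A' A').card := by
    have : Finset.image₂ (fun a b => a + 2 * b) A A =
        (Finset.image₂ (fun a b => a + 2 * b) A' A').image (fun x => 3 * u + x * d) := by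
      conv_lhs => rw [hAA]
      ext x
      simp only [Finset.mem_image₂, Finset.mem_image]
      constructor
      · rintro ⟨_, ⟨a, ha, rfl⟩, _, ⟨b, hb, rfl⟩, rfl⟩
        exact ⟨_, ⟨a, ha, b, hb, rfl⟩, by ring⟩
      · rintro ⟨_, ⟨a, ha, b, hb, rfl⟩, rfl⟩
        exact ⟨_, ⟨a, ha, rfl⟩, _, ⟨b, hb, rfl⟩, by ring⟩
    rw [this, Finset.card_image_of_injective]
    intro x y hxy
    simp only [add_right_inj] at hxy
    exact mul_right_cancel₀ hdpos.ne' hxy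
  have hne' : A'.Nonempty := hne.image _
  have h0 : (0 : ℤ) ∈ A' := Finset.mem_image.2 ⟨u, hu', by simp [hf]⟩
  have hnn : ∀ x ∈ A', 0 ≤ x := by
    intro x hx
    obtain ⟨a, ha, rfl⟩ := Finset.mem_image.1 hx
    exact Int.ediv_nonneg (by linarith [humin a ha]) hdpos.le
  obtain ⟨l, hl⟩ := Int.eq_ofNat_of_zero_le (hnn _ (A'.max'_mem hne'))
  have hlm : (l : ℤ) ∈ A' := by rw [← hl]; exact A'.max'_mem hne'
  have hr : ∀ a ∈ A', 0 ≤ a ∧ a ≤ l := fun a ha => ⟨hnn a ha, by rw [← hl]; exact A'.le_max' a ha⟩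
  have hl0 : 0 < l := by
    by_contra hcon
    have : A' ⊆ {0} := by
      intro a ha
      have := hr a ha
      simp; omega
    have := Finset.card_le_card this
    simp at this
    omega
  have hgen : ∀ K : AddSubgroup ℤ, (∀ a ∈ A', a ∈ K) → (1 : ℤ) ∈ K := by
    intro K hK
    have hle : D ≤ K.map (AddMonoidHom.mulRight d) := by
      rw [hD, AddSubgroup.closure_le]
      rintro _ ⟨a, ha, rfl⟩
      refine ⟨f a, hK _ (Finset.mem_image_of_mem _ ha), ?_⟩
      have := hfa a ha
      simp only [AddMonoidHom.coe_mulRight]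
      omega
    have hdD : d ∈ D := by rw [hmemD, hd, dvd_abs]
    obtain ⟨x, hx, hxd⟩ := hle hdD
    simp only [AddMonoidHom.coe_mulRight] at hxd
    have : x = 1 := mul_right_cancel₀ hdpos.ne' (by rw [hxd, one_mul])
    rwa [← this]
  have main := normalized A' l hl0 h0 hlm hr hgen (by rw [cA', ← cS]; omega)
  rw [cA', ← cS] at main
  refine ⟨u, d, l + 1, ?_, by push_cast; omega, by omega⟩
  intro a ha
  have h1 := hr (f a) (Finset.mem_image_of_mem _ ha)
  refine Finset.mem_image.2 ⟨(f a).toNat, Finset.mem_range.2 (by omega), ?_⟩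
  rw [Int.toNat_of_nonneg h1.1]
  exact (hfa a ha).symm
end

section
/- For every finite nonempty set A of integers and every integer r ≥ 3, one has |A + r∗A| ≥ max(4|A| − 4, 1), and in particular |A + r∗A| ≥ 3|A| − 2. -/
open scoped Pointwise

namespace Dil

abbrev cl (r : ℕ) (A : Finset ℤ) (c : ZMod r) : Finset ℤ := A.filter (fun x => ((x : ℤ) : ZMod r) = c)

abbrev S (r : ℕ) (A B : Finset ℤ) : Finset ℤ := Finset.image₂ (fun a b => a + (r : ℤ) * b) A B

lemma cd {X Y : Finset ℤ} (hX : X.Nonempty) (hY : Y.Nonempty) :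
    X.card + Y.card ≤ (X + Y).card + 1 := by
  have := cauchy_davenport_add_of_linearOrder_isCancelAdd hX hY
  omega

lemma card_cl (r : ℕ) [NeZero r] (A : Finset ℤ) : A.card = ∑ c : ZMod r, (cl r A c).card :=
  Finset.card_eq_sum_card_fiberwise (fun x _ => Finset.mem_coe.2 (Finset.mem_univ _))

lemma card_cl_shift (r : ℕ) [NeZero r] (A : Finset ℤ) (i : ZMod r) :
    A.card = ∑ c : ZMod r, (cl r A (c - i)).card := by
  rw [card_cl r A]
  exact (Equiv.sum_comp (Equiv.subRight i) (fun c => (cl r A c).card)).symm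

lemma add_sub_cl {r : ℕ} {X A A1 : Finset ℤ} {i : ZMod r} (hs : A1 ⊆ A)
    (h1 : ∀ x ∈ A1, ((x : ℤ) : ZMod r) = i) (c : ZMod r) :
    cl r X (c - i) + A1 ⊆ cl r (X + A) c := by
  intro z hz
  obtain ⟨x, hx, y, hy, rfl⟩ := Finset.mem_add.1 hz
  rw [Finset.mem_filter] at hx ⊢
  refine ⟨Finset.add_mem_add hx.1 (hs hy), ?_⟩
  push_cast
  rw [hx.2, h1 y hy]; ring

lemma full1 {r : ℕ} [NeZero r] {X A A1 : Finset ℤ} {i : ZMod r} (hs : A1 ⊆ A)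
    (h1 : ∀ x ∈ A1, ((x : ℤ) : ZMod r) = i) (hne : A1.Nonempty)
    (hX : ∀ c, (cl r X c).Nonempty) :
    X.card + r * A1.card ≤ (X + A).card + r ∧
    ((X + A).card + r = X.card + r * A1.card → ∀ c, cl r (X + A) c = cl r X (c - i) + A1) := by
  have key : ∀ c : ZMod r, (cl r X (c - i)).card + A1.card ≤ (cl r (X + A) c).card + 1 := by
    intro c
    have h := cd (hX (c - i)) hne
    have h' := Finset.card_le_card (add_sub_cl (X := X) hs h1 c)
    omega
  have e1 : ∑ c : ZMod r, ((cl r X (c - i)).card + A1.card) = X.card + r * A1.card := by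
    rw [Finset.sum_add_distrib, ← card_cl_shift]; simp [ZMod.card]
  have e2 : ∑ c : ZMod r, ((cl r (X + A) c).card + 1) = (X + A).card + r := by
    rw [Finset.sum_add_distrib, ← card_cl]; simp [ZMod.card]
  refine ⟨by rw [← e1, ← e2]; exact Finset.sum_le_sum (fun c _ => key c), ?_⟩
  intro heq c
  rw [← e1, ← e2] at heq
  have := (Finset.sum_eq_sum_iff_of_le (fun c _ => key c)).1 heq.symm c (Finset.mem_univ _)
  symm
  apply Finset.eq_of_subset_of_card_le (add_sub_cl hs h1 c)
  have h := cd (hX (c - i)) hne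
  omega

lemma min_add {X Y : Finset ℤ} (hX : X.Nonempty) (hY : Y.Nonempty) (h : (X + Y).Nonempty) :
    (X + Y).min' h = X.min' hX + Y.min' hY := by
  apply le_antisymm
  · exact Finset.min'_le _ _ (Finset.add_mem_add (Finset.min'_mem _ _) (Finset.min'_mem _ _))
  · apply Finset.le_min'
    intro z hz
    obtain ⟨x, hx, y, hy, rfl⟩ := Finset.mem_add.1 hz
    exact add_le_add (Finset.min'_le _ _ hx) (Finset.min'_le _ _ hy)

lemma full2 {r : ℕ} [NeZero r] {X A A1 A2 : Finset ℤ} {i j : ZMod r} (hs : A1 ⊆ A) (hs2 : A2 ⊆ A)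
    (h1 : ∀ x ∈ A1, ((x : ℤ) : ZMod r) = i) (hne : A1.Nonempty)
    (h2 : ∀ x ∈ A2, ((x : ℤ) : ZMod r) = j) (hne2 : A2.Nonempty) (hij : i ≠ j)
    (hX : ∀ c, (cl r X c).Nonempty) (hc : A1.card = A2.card) :
    X.card + r * A1.card + 1 ≤ (X + A).card + r := by
  obtain ⟨p1, q1⟩ := full1 hs h1 hne hX
  obtain ⟨p2, q2⟩ := full1 hs2 h2 hne2 hX
  by_contra hlt
  have e1 := q1 (by omega)
  have e2 := q2 (by rw [← hc]; omega)
  have hm : ∀ c : ZMod r, (cl r X (c - i)).min' (hX _) + A1.min' hne =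
      (cl r X (c - j)).min' (hX _) + A2.min' hne2 := by
    intro c
    rw [← min_add (hX _) hne ((hX _).add hne), ← min_add (hX _) hne2 ((hX _).add hne2)]
    have := (e1 c).symm.trans (e2 c)
    congr 1
  have hsum := Finset.sum_congr (s₁ := (Finset.univ : Finset (ZMod r))) rfl (fun c _ => hm c)
  have hsh : ∀ k : ZMod r, ∑ c : ZMod r, (cl r X (c - k)).min' (hX _) =
      ∑ c : ZMod r, (cl r X c).min' (hX c) :=
    fun k => Equiv.sum_comp (Equiv.subRight k) (fun c => (cl r X c).min' (hX c))
  rw [Finset.sum_add_distrib, Finset.sum_add_distrib, hsh i, hsh j] at hsum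
  simp only [Finset.sum_const, Finset.card_univ, ZMod.card, nsmul_eq_mul] at hsum
  have hr : (r : ℤ) ≠ 0 := by exact_mod_cast NeZero.ne r
  have : A1.min' hne = A2.min' hne2 := mul_left_cancel₀ hr (by linarith)
  apply hij
  rw [← h1 _ (Finset.min'_mem _ hne), ← h2 _ (Finset.min'_mem _ hne2), this]

lemma notfull {r : ℕ} {X A A1 A2 : Finset ℤ} {i j : ZMod r} (hs : A1 ⊆ A) (hs2 : A2 ⊆ A)
    (h1 : ∀ x ∈ A1, ((x : ℤ) : ZMod r) = i)
    (h2 : ∀ x ∈ A2, ((x : ℤ) : ZMod r) = j)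
    (x : ℤ) (hx : x ∈ X) (hx' : ∀ y ∈ X, ((y : ℤ) : ZMod r) ≠ x + (j - i)) :
    (X + A1).card + A2.card ≤ (X + A).card := by
  have hd : Disjoint (X + A1) (A2.image (fun y => x + y)) := by
    rw [Finset.disjoint_left]
    intro z hz hz'
    obtain ⟨u, hu, v, hv, rfl⟩ := Finset.mem_add.1 hz
    obtain ⟨w, hw, e⟩ := Finset.mem_image.1 hz'
    apply hx' u hu
    have e' := congrArg (fun t : ℤ => (t : ZMod r)) e
    push_cast at e'
    rw [h1 v hv, h2 w hw] at e'
    rw [← add_sub_assoc, e']; ring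
  have hc : (A2.image (fun y => x + y)).card = A2.card :=
    Finset.card_image_of_injective _ (add_right_injective x)
  rw [← hc, ← Finset.card_union_of_disjoint hd]
  apply Finset.card_le_card
  apply Finset.union_subset
  · exact Finset.add_subset_add_left hs
  · intro z hz
    obtain ⟨w, hw, rfl⟩ := Finset.mem_image.1 hz
    exact Finset.add_mem_add hx (hs2 hw)

lemma exX {r : ℕ} [NeZero r] {A1 : Finset ℤ} {i : ZMod r} 
    (h1 : ∀ x ∈ A1, ((x : ℤ) : ZMod r) = i) (hne : A1.Nonempty) :
    ∃ X : Finset ℤ, X.Nonempty ∧ X.card = A1.card ∧ ∀ B, (S r A1 B).card = (X + B).card := by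
  obtain ⟨a, ha⟩ := hne
  have hr : (r : ℤ) ≠ 0 := by exact_mod_cast NeZero.ne r
  have hinj : Function.Injective (fun x : ℤ => (r : ℤ) * x + a) := by
    intro x y h
    exact mul_left_cancel₀ hr (by simpa using h)
  have hdiv : ∀ x ∈ A1, (r : ℤ) * ((x - a) / r) + a = x := by
    intro x hx
    have : (r : ℤ) ∣ x - a := by
      rw [← ZMod.intCast_zmod_eq_zero_iff_dvd]
      push_cast
      rw [h1 x hx, h1 a ha, sub_self]
    rw [Int.mul_ediv_cancel' this]; ring
  have hA : A1 = (A1.image (fun x => (x - a) / (r : ℤ))).image (fun x : ℤ => (r : ℤ) * x + a) := by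
    ext x
    simp only [Finset.mem_image, exists_exists_and_eq_and]
    constructor
    · intro hx; exact ⟨x, hx, hdiv x hx⟩
    · rintro ⟨y, hy, rfl⟩; rw [hdiv y hy]; exact hy
  refine ⟨A1.image (fun x => (x - a) / (r : ℤ)), ⟨_, Finset.mem_image_of_mem _ ha⟩, ?_, ?_⟩
  · conv_rhs => rw [hA]
    rw [Finset.card_image_of_injective _ hinj]
  · intro B
    generalize A1.image (fun x => (x - a) / (r : ℤ)) = X at hA
    rw [hA, ← Finset.card_image_of_injective (X + B) hinj]
    congr 1
    ext z
    simp only [S, Finset.mem_image₂, Finset.mem_image, Finset.mem_add]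
    constructor
    · rintro ⟨_, ⟨x, hx, rfl⟩, b, hb, rfl⟩
      exact ⟨_, ⟨x, hx, b, hb, rfl⟩, by ring⟩
    · rintro ⟨_, ⟨x, hx, b, hb, rfl⟩, rfl⟩
      exact ⟨_, ⟨x, hx, rfl⟩, b, hb, by ring⟩

lemma cl_S {r : ℕ} (A B : Finset ℤ) (c : ZMod r) : cl r (S r A B) c = S r (cl r A c) B := by
  ext z
  simp only [S, Finset.mem_image₂, Finset.mem_filter]
  constructor
  · rintro ⟨⟨a, ha, b, hb, rfl⟩, h⟩
    exact ⟨a, ⟨ha, by simpa using h⟩, b, hb, rfl⟩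
  · rintro ⟨a, ⟨ha, h⟩, b, hb, rfl⟩
    exact ⟨⟨a, ha, b, hb, rfl⟩, by simpa using h⟩

set_option maxHeartbeats 2000000 in
lemma prim (r : ℕ) (hr : 3 ≤ r) (A : Finset ℤ) (hA : 2 ≤ A.card)
    (hp : ∀ g : ℕ, (∀ a ∈ A, ∀ b ∈ A, (g : ℤ) ∣ a - b) → g = 1)
    (ih : ∀ B : Finset ℤ, B.card < A.card → B.Nonempty →
      4 * B.card ≤ (S r B B).card + 4 ∧ 1 ≤ (S r B B).card) :
    4 * A.card ≤ (S r A A).card + 4 := by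
  haveI : NeZero r := ⟨by omega⟩
  have hAne : A.Nonempty := Finset.card_pos.1 (by omega)
  set J := A.image (fun x : ℤ => (x : ZMod r)) with hJ
  have hcard : (S r A A).card = ∑ c : ZMod r, (S r (cl r A c) A).card := by
    rw [card_cl r]
    simp only [cl_S]
  have hJne : ∀ c ∈ J, (cl r A c).Nonempty := by
    intro c hc
    obtain ⟨x, hx, e⟩ := Finset.mem_image.1 hc
    exact ⟨x, Finset.mem_filter.2 ⟨hx, e⟩⟩
  have hJsum : A.card = ∑ c ∈ J, (cl r A c).card :=
    Finset.card_eq_sum_card_fiberwise (fun x hx => Finset.mem_coe.2 (Finset.mem_image_of_mem _ hx))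
  have hcl : ∀ c : ZMod r, ∀ x ∈ cl r A c, ((x : ℤ) : ZMod r) = c :=
    fun c x hx => (Finset.mem_filter.1 hx).2
  have hJ2 : 2 ≤ J.card := by
    by_contra hlt
    have h1 : J.card ≤ 1 := by omega
    have := hp r (by
      intro a ha b hb
      rw [← ZMod.intCast_zmod_eq_zero_iff_dvd]
      push_cast
      rw [Finset.card_le_one.1 h1 _ (Finset.mem_image_of_mem _ ha) _ (Finset.mem_image_of_mem _ hb),
        sub_self])
    omega
  rcases Nat.lt_or_ge 2 J.card with h3 | h3
  · have h : A.card + J.card * A.card ≤ (S r A A).card + J.card := by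
      have e1 : ∑ c ∈ J, ((cl r A c).card + A.card) = A.card + J.card * A.card := by
        rw [Finset.sum_add_distrib, ← hJsum]; simp
      have e2 : ∑ c ∈ J, ((S r (cl r A c) A).card + 1) ≤ (S r A A).card + J.card := by
        rw [Finset.sum_add_distrib, hcard, ← Finset.card_eq_sum_ones]
        exact Nat.add_le_add_right (Finset.sum_le_sum_of_subset (Finset.subset_univ J)) _
      rw [← e1]
      refine le_trans (Finset.sum_le_sum ?_) e2
      intro c hc
      obtain ⟨X, hX, hXc, hXS⟩ := exX (hcl c) (hJne c hc)
      rw [hXS, ← hXc]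
      exact cd hX hAne
    obtain ⟨k, hk⟩ : ∃ k, J.card = k + 3 := ⟨J.card - 3, by omega⟩
    rw [hk] at h
    nlinarith
  · obtain ⟨i, j, hij, hJe⟩ := Finset.card_eq_two.1 (le_antisymm h3 hJ2)
    have hi : i ∈ J := by rw [hJe]; simp
    have hj : j ∈ J := by rw [hJe]; simp
    have hA1 := hJne i hi
    have hA2 := hJne j hj
    have hsum : A.card = (cl r A i).card + (cl r A j).card := by
      rw [hJsum, hJe, Finset.sum_pair hij]
    have hSS : (S r (cl r A i) A).card + (S r (cl r A j) A).card ≤ (S r A A).card := by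
      rw [hcard, ← Finset.sum_pair (f := fun c => (S r (cl r A c) A).card) hij]
      exact Finset.sum_le_sum_of_subset (Finset.subset_univ _)
    have hunit : IsUnit (j - i) := by
      obtain ⟨x, hx⟩ := hA1
      obtain ⟨y, hy⟩ := hA2
      have hd : (((y - x : ℤ)) : ZMod r) = j - i := by
        push_cast; rw [hcl _ _ hx, hcl _ _ hy]
      rw [← hd, ZMod.coe_int_isUnit_iff_isCoprime, Int.isCoprime_iff_gcd_eq_one]
      apply hp
      have hgr : ((Int.gcd r (y - x) : ℕ) : ℤ) ∣ r := Int.gcd_dvd_left ..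
      have hgd : ((Int.gcd r (y - x) : ℕ) : ℤ) ∣ y - x := Int.gcd_dvd_right ..
      have hx0 : ∀ a ∈ A, ((Int.gcd r (y - x) : ℕ) : ℤ) ∣ a - x := by
        intro a ha
        have : ((a : ℤ) : ZMod r) ∈ J := Finset.mem_image_of_mem _ ha
        rw [hJe, Finset.mem_insert, Finset.mem_singleton] at this
        rcases this with h | h
        · have : (r : ℤ) ∣ a - x := by
            rw [← ZMod.intCast_zmod_eq_zero_iff_dvd]
            push_cast; rw [h, hcl _ _ hx, sub_self]
          exact hgr.trans this
        · have : (r : ℤ) ∣ a - y := by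
            rw [← ZMod.intCast_zmod_eq_zero_iff_dvd]
            push_cast; rw [h, hcl _ _ hy, sub_self]
          have := dvd_add (hgr.trans this) hgd
          simpa using this
      intro a ha b hb
      have := dvd_sub (hx0 a ha) (hx0 b hb)
      simpa using this
    -- dichotomy
    have dich : ∀ (d : ZMod r), IsUnit d → ∀ X : Finset ℤ, X.Nonempty →
        (∀ c, (cl r X c).Nonempty) ∨ ∃ x ∈ X, ∀ y ∈ X, ((y : ℤ) : ZMod r) ≠ x + d := by
      intro d hd X hX
      by_cases hcon : ∃ x ∈ X, ∀ y ∈ X, ((y : ℤ) : ZMod r) ≠ x + d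
      · exact Or.inr hcon
      · left
        push Not at hcon
        obtain ⟨x, hx⟩ := hX
        have hk : ∀ k : ℕ, ∃ y ∈ X, ((y : ℤ) : ZMod r) = x + k * d := by
          intro k
          induction k with
          | zero => exact ⟨x, hx, by simp⟩
          | succ k ihk =>
            obtain ⟨y, hy, e⟩ := ihk
            obtain ⟨z, hz, e'⟩ := hcon y hy
            exact ⟨z, hz, by rw [e', e]; push_cast; ring⟩
        intro c
        obtain ⟨u, rfl⟩ := hd
        obtain ⟨y, hy, e⟩ := hk ((c - x) * (↑u⁻¹ : ZMod r)).val
        refine ⟨y, Finset.mem_filter.2 ⟨hy, ?_⟩⟩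
        rw [e, ZMod.natCast_zmod_val, mul_assoc, Units.inv_mul]; ring
    -- bounds for one class
    have main : ∀ i j : ZMod r, i ≠ j → IsUnit (j - i) → (cl r A i).Nonempty →
        (cl r A j).Nonempty → A.card = (cl r A i).card + (cl r A j).card →
        (3 ≤ (cl r A i).card ∧ 
          4 * (cl r A i).card ≤ (S r (cl r A i) A).card + 3 ∧ 
          (cl r A i).card + 3 * (cl r A j).card ≤ (S r (cl r A i) A).card + 3 ∧ 
          ((cl r A i).card = (cl r A j).card → 
            4 * (cl r A i).card + 1 ≤ (S r (cl r A i) A).card + 3)) ∨ 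
        (4 * (cl r A i).card + (cl r A j).card ≤ (S r (cl r A i) A).card + 4 ∧ 
          1 + (cl r A j).card ≤ (S r (cl r A i) A).card) := by
      intro i j hij hu hA1 hA2 hsum
      have s1 : cl r A i ⊆ A := Finset.filter_subset _ _
      have s2 : cl r A j ⊆ A := Finset.filter_subset _ _
      obtain ⟨X, hX, hXc, hXS⟩ := exX (hcl i) hA1
      have p1 := hA1.card_pos
      have p2 := hA2.card_pos
      rcases dich _ hu X hX with hf | ⟨x, hx, hx'⟩
      · left
        have f1 := (full1 s1 (hcl i) hA1 hf).1
        have f2 := (full1 s2 (hcl j) hA2 hf).1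
        have f3 := full2 s1 s2 (hcl i) hA1 (hcl j) hA2 hij hf
        have hrX : r ≤ X.card := by
          have : ∑ c : ZMod r, 1 ≤ ∑ c : ZMod r, (cl r X c).card :=
            Finset.sum_le_sum (fun c _ => (hf c).card_pos)
          rw [← card_cl] at this
          simpa [ZMod.card] using this
        rw [← hXS] at f1 f2 f3
        rw [hXc] at f1 f2 f3 hrX
        refine ⟨by omega, by nlinarith, by nlinarith, fun h => ?_⟩
        have := f3 h
        nlinarith
      · right
        have h := notfull s1 s2 (hcl i) (hcl j) x hx hx'
        rw [← hXS, ← hXS] at h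
        obtain ⟨q1, q2⟩ := ih (cl r A i) (by omega) hA1
        omega
    have m1 := main i j hij hunit hA1 hA2 hsum
    have m2 := main j i hij.symm (by rw [← neg_sub]; exact hunit.neg) hA2 hA1 (by omega)
    have p1 := hA1.card_pos
    have p2 := hA2.card_pos
    generalize (cl r A i).card = a at *
    generalize (cl r A j).card = b at *
    rcases m1 with ⟨_, _, _, _⟩ | ⟨_, _⟩ <;> rcases m2 with ⟨_, _, _, _⟩ | ⟨_, _⟩ <;> omega

lemma normalize (r : ℕ) (A : Finset ℤ) (hA : 2 ≤ A.card) :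
    ∃ B : Finset ℤ, B.card = A.card ∧ (S r B B).card = (S r A A).card ∧
      ∀ g : ℕ, (∀ a ∈ B, ∀ b ∈ B, (g : ℤ) ∣ a - b) → g = 1 := by
  obtain ⟨a0, ha0, a1, ha1, hne⟩ := Finset.one_lt_card.1 hA
  obtain ⟨f, hf, hg⟩ := Finset.extract_gcd (fun x => x - a0) ⟨a0, ha0⟩
  set g := A.gcd (fun x => x - a0) with hgdef
  have hg0 : g ≠ 0 := by
    intro h
    have := Finset.gcd_eq_zero_iff.1 h a1 ha1
    exact hne (by linarith [show a1 - a0 = 0 from this])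
  have hinj : Function.Injective (fun x : ℤ => g * x + a0) := by
    intro x y h
    exact mul_left_cancel₀ hg0 (by simpa using h)
  have hinj2 : Function.Injective (fun x : ℤ => g * x + (a0 + r * a0)) := by
    intro x y h
    exact mul_left_cancel₀ hg0 (by simpa using h)
  have hdiv : ∀ x ∈ A, g * f x + a0 = x := by
    intro x hx
    have := hf x hx
    linarith
  have hAe : A = (A.image f).image (fun x : ℤ => g * x + a0) := by
    ext x
    simp only [Finset.mem_image, exists_exists_and_eq_and]
    constructor
    · intro hx; exact ⟨x, hx, hdiv x hx⟩
    · rintro ⟨y, hy, rfl⟩; rw [hdiv y hy]; exact hy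
  refine ⟨A.image f, ?_, ?_, ?_⟩
  · conv_rhs => rw [hAe]
    rw [Finset.card_image_of_injective _ hinj]
  · clear_value g
    generalize A.image f = B at hAe
    rw [hAe, ← Finset.card_image_of_injective (S r B B) hinj2]
    congr 1
    ext z
    simp only [S, Finset.mem_image₂, Finset.mem_image]
    constructor
    · rintro ⟨_, ⟨x, hx, b, hb, rfl⟩, rfl⟩
      exact ⟨_, ⟨x, hx, rfl⟩, _, ⟨b, hb, rfl⟩, by ring⟩
    · rintro ⟨_, ⟨x, hx, rfl⟩, _, ⟨b, hb, rfl⟩, rfl⟩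
      exact ⟨_, ⟨x, hx, b, hb, rfl⟩, by ring⟩
  · intro k hk
    have hf0 : f a0 = 0 := by
      have := hdiv a0 ha0
      have : g * f a0 = 0 := by linarith
      exact (mul_eq_zero.1 this).resolve_left hg0
    have : (k : ℤ) ∣ A.gcd f := by
      apply Finset.dvd_gcd
      intro x hx
      have := hk (f x) (Finset.mem_image_of_mem _ hx) (f a0) (Finset.mem_image_of_mem _ ha0)
      simpa [hf0] using this
    rw [hg] at this
    exact Nat.dvd_one.1 (by exact_mod_cast this)

lemma bound (r : ℕ) (hr : 3 ≤ r) : ∀ n : ℕ, ∀ A : Finset ℤ, A.card = n → A.Nonempty →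
    4 * A.card ≤ (S r A A).card + 4 ∧ 1 ≤ (S r A A).card := by
  intro n
  induction n using Nat.strong_induction_on with
  | _ n ih =>
    intro A hn hA
    refine ⟨?_, (hA.image₂ hA).card_pos⟩
    by_cases h : 2 ≤ A.card
    · obtain ⟨B, hB, hS, hp⟩ := normalize r A h
      rw [← hS, ← hB]
      apply prim r hr B (by omega) hp
      intro C hC hCne
      exact ih C.card (by omega) C rfl hCne
    · omega

end Dil

theorem stmt3 (A : Finset ℤ) (hA : A.Nonempty) (r : ℤ) (hr : 3 ≤ r) :
    max (4 * (A.card : ℤ) - 4) 1 ≤ (Finset.image₂ (fun a b => a + r * b) A A).card ∧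
    3 * (A.card : ℤ) - 2 ≤ (Finset.image₂ (fun a b => a + r * b) A A).card := by
  lift r to ℕ using by omega
  have h := Dil.bound r (by omega) _ A rfl hA
  have := hA.card_pos
  simp only [Dil.S] at h
  omega
end

section
/- If S = bᵐ·a^A is a finite nonempty subset of BS(1,2), where m ≥ 2 is an integer and A ⊆ ℤ is finite with |A| = k, then S² = b^(2m)·a^(A + 2ᵐ∗A) and |S²| = |A + 2ᵐ∗A| ≥ max(4k − 4, 1) ≥ 3k − 2. -/
open Pointwise

def BSRel (n : ℤ) : Set (FreeGroup Bool) :=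
  {FreeGroup.of true * FreeGroup.of false * (FreeGroup.of false * FreeGroup.of true ^ n)⁻¹}

/-- The Baumslag–Solitar group `BS(1,n) = ⟨a, b ∣ a b = b aⁿ⟩`. -/
abbrev BS (n : ℤ) : Type := PresentedGroup (BSRel n)

noncomputable instance (n : ℤ) : DecidableEq (BS n) := Classical.decEq _

/-- The generator `a` of `BS(1,n)`. -/
def bsa (n : ℤ) : BS n := PresentedGroup.of true

/-- The generator `b` of `BS(1,n)`. -/
def bsb (n : ℤ) : BS n := PresentedGroup.of false

/-! ### Combinatorial part -/

lemma cdav (X Y : Finset ℤ) (hX : X.Nonempty) (hY : Y.Nonempty) :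
    X.card + Y.card ≤ (X + Y).card + 1 := by
  have := cauchy_davenport_add_of_linearOrder_isCancelAdd hX hY
  omega

lemma fiber_bound (r : ℕ) (X Y : Finset ℤ) (hY : Y.Nonempty) (u : ZMod r)
    (hu : ∀ y ∈ Y, (y : ZMod r) = u) :
    X.card + (X.image (fun x : ℤ => (x : ZMod r))).card * (Y.card - 1) ≤ (X + Y).card := by
  classical
  set R := X.image (fun x : ℤ => (x : ZMod r)) with hR
  have h1 : X.card = ∑ ρ ∈ R, (X.filter (fun x : ℤ => (x : ZMod r) = ρ)).card :=
    Finset.card_eq_sum_card_fiberwise (fun x hx => Finset.mem_image_of_mem _ hx)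
  have h2 : (X + Y).card = ∑ ρ ∈ R, ((X + Y).filter (fun x : ℤ => (x : ZMod r) - u = ρ)).card := by
    apply Finset.card_eq_sum_card_fiberwise
    intro z hz
    obtain ⟨x, hx, y, hy, rfl⟩ := Finset.mem_add.1 hz
    simp only [Finset.mem_coe, Int.cast_add, hu y hy, add_sub_cancel_right]
    exact Finset.mem_image_of_mem _ hx
  rw [h2, h1, ← smul_eq_mul, ← Finset.sum_const, ← Finset.sum_add_distrib]
  apply Finset.sum_le_sum
  intro ρ hρ
  have hne : (X.filter (fun x : ℤ => (x : ZMod r) = ρ)).Nonempty := by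
    obtain ⟨x, hx, rfl⟩ := Finset.mem_image.1 hρ
    exact ⟨x, by simp [hx]⟩
  have h3 := cdav _ Y hne hY
  have h4 : X.filter (fun x : ℤ => (x : ZMod r) = ρ) + Y ⊆
      (X + Y).filter (fun x : ℤ => (x : ZMod r) - u = ρ) := by
    intro z hz
    obtain ⟨x, hx, y, hy, rfl⟩ := Finset.mem_add.1 hz
    rw [Finset.mem_filter] at hx ⊢
    refine ⟨Finset.add_mem_add hx.1 hy, ?_⟩
    simp [hu y hy, hx.2]
  have h5 := Finset.card_le_card h4
  have := hY.card_pos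
  omega

lemma stable_full (r : ℕ) [NeZero r] (R : Finset (ZMod r)) (hR : R.Nonempty) (u : ZMod r)
    (hu : IsUnit u) (h : ∀ ρ ∈ R, ρ + u ∈ R) : R.card = r := by
  have key : R = Finset.univ := by
    obtain ⟨ρ, hρ⟩ := hR
    have hn : ∀ n : ℕ, ρ + n * u ∈ R := by
      intro n
      induction n with
      | zero => simpa using hρ
      | succ n ih =>
        have := h _ ih
        convert this using 1
        push_cast; ring
    ext z
    simp only [Finset.mem_univ, iff_true]
    obtain ⟨v, rfl⟩ := hu
    have := hn ((z - ρ) * (↑(v⁻¹) : ZMod r)).val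
    rw [ZMod.natCast_zmod_val, mul_assoc, Units.inv_mul] at this
    simpa using this
  rw [key, Finset.card_univ, ZMod.card]

lemma two_class (r : ℕ) (hr : 4 ≤ r) (X A1 A2 : Finset ℤ) (hX : X.Nonempty)
    (h2 : A2.Nonempty) (h12 : A2.card ≤ A1.card) (hX1 : X.card ≤ A1.card)
    (u1 u2 : ZMod r) (hu1 : ∀ y ∈ A1, (y : ZMod r) = u1) (hu2 : ∀ y ∈ A2, (y : ZMod r) = u2)
    (hu : IsUnit (u2 - u1)) :
    2 * X.card + A1.card + A2.card ≤ (X + (A1 ∪ A2)).card + 2 := by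
  classical
  have : NeZero r := ⟨by omega⟩
  have h1 : A1.Nonempty := Finset.card_pos.1 (lt_of_lt_of_le h2.card_pos h12)
  have p1 := h1.card_pos
  have p2 := h2.card_pos
  have hb := fiber_bound r X A1 h1 u1 hu1
  set R := X.image (fun x : ℤ => (x : ZMod r)) with hR
  have hRne : R.Nonempty := hX.image _
  have hRX : R.card ≤ X.card := Finset.card_image_le
  have hsub : X + A1 ⊆ X + (A1 ∪ A2) := Finset.add_subset_add_left Finset.subset_union_left
  obtain ⟨a, ha⟩ : ∃ a, A1.card = a + 1 := ⟨A1.card - 1, by omega⟩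
  rw [ha] at hb
  simp only [Nat.add_sub_cancel] at hb
  by_cases hst : ∀ ρ ∈ R, ρ + (u2 - u1) ∈ R
  · have ht := stable_full r R hRne _ hu hst
    have h5 := Finset.card_le_card hsub
    have : 4 * a ≤ R.card * a := Nat.mul_le_mul_right _ (by omega)
    omega
  · push Not at hst
    obtain ⟨ρ, hρ, hρ'⟩ := hst
    set Xρ := X.filter (fun x : ℤ => (x : ZMod r) = ρ) with hXρ
    have hne : Xρ.Nonempty := by
      obtain ⟨x, hx, rfl⟩ := Finset.mem_image.1 hρ
      exact ⟨x, by simp [hXρ, hx]⟩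
    have hdis : Disjoint (X + A1) (Xρ + A2) := by
      rw [Finset.disjoint_left]
      intro z hz hz'
      obtain ⟨x, hx, y, hy, rfl⟩ := Finset.mem_add.1 hz
      obtain ⟨x', hx', y', hy', he⟩ := Finset.mem_add.1 hz'
      rw [hXρ, Finset.mem_filter] at hx'
      have he' : ((x' + y' : ℤ) : ZMod r) = ((x + y : ℤ) : ZMod r) := by rw [he]
      push_cast at he'
      rw [hx'.2, hu1 y hy, hu2 y' hy'] at he'
      apply hρ'
      have : ρ + (u2 - u1) = (x : ZMod r) := by
        rw [← add_sub_assoc, he']; ring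
      rw [this]
      exact Finset.mem_image_of_mem _ hx
    have hsub2 : (X + A1) ∪ (Xρ + A2) ⊆ X + (A1 ∪ A2) :=
      Finset.union_subset hsub
        (Finset.add_subset_add (Finset.filter_subset _ _) Finset.subset_union_right)
    have h5 := Finset.card_le_card hsub2
    rw [Finset.card_union_of_disjoint hdis] at h5
    have h6 := cdav _ _ hne h2
    have h7 := hne.card_pos
    rcases Nat.lt_or_ge R.card 2 with ht | ht
    · have ht1 : R.card = 1 := by have := hRne.card_pos; omega
      obtain ⟨σ, hσ⟩ := Finset.card_eq_one.1 ht1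
      have hall : Xρ = X := by
        rw [hXρ, Finset.filter_true_of_mem]
        intro x hx
        have hx' : (x : ZMod r) ∈ R := Finset.mem_image_of_mem _ hx
        rw [hσ, Finset.mem_singleton] at hx' hρ
        rw [hx', hρ]
      rw [hall] at h6 h5
      rw [ht1] at hb
      omega
    · have : 2 * a ≤ R.card * a := Nat.mul_le_mul_right _ ht
      omega

lemma dilate_class (r : ℕ) (hr : 0 < r) (A1 A : Finset ℤ)
    (v : ZMod r) (hv : ∀ y ∈ A1, (y : ZMod r) = v) (h1 : A1.Nonempty) :
    ∃ X : Finset ℤ, X.card = A1.card ∧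
      (X + A).card = (A1 + A.image (fun x => (r : ℤ) * x)).card := by
  classical
  obtain ⟨a, ha⟩ := h1
  have hinj : Function.Injective (fun w : ℤ => a + (r : ℤ) * w) := by
    intro x y hxy
    have h0 : r ≠ 0 := by omega
    simpa [h0] using hxy
  have hq : ∀ y ∈ A1, a + (r : ℤ) * ((y - a) / r) = y := by
    intro y hy
    have : ((y - a : ℤ) : ZMod r) = 0 := by push_cast; rw [hv y hy, hv a ha, sub_self]
    rw [Int.mul_ediv_cancel' ((ZMod.intCast_zmod_eq_zero_iff_dvd _ _).1 this)]
    ring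
  have him : (A1.image (fun y => (y - a) / (r : ℤ))).image (fun w : ℤ => a + (r : ℤ) * w) = A1 := by
    rw [Finset.image_image]
    ext z
    simp only [Finset.mem_image, Function.comp]
    constructor
    · rintro ⟨y, hy, rfl⟩; rw [hq y hy]; exact hy
    · intro hz; exact ⟨z, hz, hq z hz⟩
  refine ⟨A1.image (fun y => (y - a) / (r : ℤ)), ?_, ?_⟩
  · conv_rhs => rw [← him]
    rw [Finset.card_image_of_injective _ hinj]
  · rw [← Finset.card_image_of_injective _ hinj]
    congr 1
    conv_rhs => rw [← him]
    ext z
    simp only [Finset.mem_image, Finset.mem_add]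
    constructor
    · rintro ⟨_, ⟨x, hx, y, hy, rfl⟩, rfl⟩
      exact ⟨a + r * x, ⟨x, hx, rfl⟩, r * y, ⟨y, hy, rfl⟩, by ring⟩
    · rintro ⟨_, ⟨x, hx, rfl⟩, _, ⟨y, hy, rfl⟩, rfl⟩
      exact ⟨x + y, ⟨x, hx, y, hy, rfl⟩, by ring⟩

lemma main_two (r : ℕ) (hr : 4 ≤ r) (A1 A2 : Finset ℤ)
    (h1 : A1.Nonempty) (h2 : A2.Nonempty) (h12 : A2.card ≤ A1.card)
    (u1 u2 : ZMod r) (hu1 : ∀ y ∈ A1, (y : ZMod r) = u1) (hu2 : ∀ y ∈ A2, (y : ZMod r) = u2)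
    (hu : IsUnit (u2 - u1)) :
    4 * (A1.card + A2.card) ≤
      ((A1 ∪ A2) + (A1 ∪ A2).image (fun x => (r : ℤ) * x)).card + 4 := by
  classical
  obtain ⟨X1, hc1, hX1⟩ := dilate_class r (by omega) A1 (A1 ∪ A2) u1 hu1 h1
  obtain ⟨X2, hc2, hX2⟩ := dilate_class r (by omega) A2 (A1 ∪ A2) u2 hu2 h2
  have b1 := two_class r hr X1 A1 A2 (Finset.card_pos.1 (hc1 ▸ h1.card_pos)) h2 h12 hc1.le
    u1 u2 hu1 hu2 hu
  have b2 := two_class r hr X2 A1 A2 (Finset.card_pos.1 (hc2 ▸ h2.card_pos)) h2 h12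
    (hc2 ▸ h12) u1 u2 hu1 hu2 hu
  set D := (A1 ∪ A2).image (fun x => (r : ℤ) * x) with hD
  have hD0 : ∀ d ∈ D, (d : ZMod r) = 0 := by
    intro d hd
    obtain ⟨x, _, rfl⟩ := Finset.mem_image.1 hd
    simp
  have hdis : Disjoint (A1 + D) (A2 + D) := by
    rw [Finset.disjoint_left]
    intro z hz hz'
    obtain ⟨x, hx, y, hy, rfl⟩ := Finset.mem_add.1 hz
    obtain ⟨x', hx', y', hy', he⟩ := Finset.mem_add.1 hz'
    have he' : ((x' + y' : ℤ) : ZMod r) = ((x + y : ℤ) : ZMod r) := by rw [he]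
    push_cast at he'
    rw [hu1 x hx, hu2 x' hx', hD0 y hy, hD0 y' hy', add_zero, add_zero] at he'
    rw [he', sub_self] at hu
    have : Fact (1 < r) := ⟨by omega⟩
    exact not_isUnit_zero hu
  rw [Finset.union_add, Finset.card_union_of_disjoint hdis]
  omega

lemma isUnit_odd (m : ℕ) (z : ℤ) (hz : Odd z) : IsUnit ((z : ZMod (2 ^ m))) := by
  rw [ZMod.coe_int_isUnit_iff_isCoprime]
  push_cast
  apply IsCoprime.pow_left
  obtain ⟨w, rfl⟩ := hz
  exact ⟨-w, 1, by ring⟩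

lemma parity_bound (m : ℕ) (hm : 2 ≤ m) (A : Finset ℤ) (h0 : 0 ∈ A) (ho : ∃ x ∈ A, Odd x) :
    4 * A.card ≤ (A + A.image (fun x => ((2 ^ m : ℕ) : ℤ) * x)).card + 4 := by
  classical
  obtain ⟨o, hoA, hodd⟩ := ho
  have hr : 4 ≤ 2 ^ m := by
    calc 4 = 2 ^ 2 := by norm_num
      _ ≤ 2 ^ m := Nat.pow_le_pow_right (by norm_num) hm
  generalize hrr : 2 ^ m = r at *
  have h2r : (2 : ℤ) ∣ r := by
    rw [← hrr]; push_cast; exact dvd_pow_self _ (by omega)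
  set D := A.image (fun x => (r : ℤ) * x) with hD
  have hDc : D.card = A.card := Finset.card_image_of_injective _ (by
    intro x y hxy
    have h0 : r ≠ 0 := by omega
    simpa [h0] using hxy)
  have hD0 : ∀ d ∈ D, (d : ZMod r) = 0 := by
    intro d hd
    obtain ⟨x, _, rfl⟩ := Finset.mem_image.1 hd
    simp
  have hAp : 0 < A.card := Finset.card_pos.2 ⟨0, h0⟩
  have hb := fiber_bound r A D (Finset.card_pos.1 (by omega)) 0 hD0
  rw [hDc] at hb
  set R := A.image (fun x : ℤ => (x : ZMod r)) with hR
  have hpar : ∀ x y : ℤ, (x : ZMod r) = (y : ZMod r) → Odd x → Odd y := by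
    intro x y hxy hx
    have h : ((x - y : ℤ) : ZMod r) = 0 := by push_cast; rw [hxy, sub_self]
    have := h2r.trans ((ZMod.intCast_zmod_eq_zero_iff_dvd _ _).1 h)
    grind
  have hno : ((0 : ℤ) : ZMod r) ≠ (o : ZMod r) := by
    intro h
    have := hpar _ _ h.symm hodd
    simp at this
  obtain ⟨k, hk⟩ : ∃ k, A.card = k + 1 := ⟨A.card - 1, by omega⟩
  rcases Nat.lt_or_ge R.card 3 with ht | ht
  · have hsub : ({((0 : ℤ) : ZMod r), (o : ZMod r)} : Finset (ZMod r)) ⊆ R := by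
      intro z hz
      rw [Finset.mem_insert, Finset.mem_singleton] at hz
      rcases hz with rfl | rfl
      · exact Finset.mem_image_of_mem _ h0
      · exact Finset.mem_image_of_mem _ hoA
    have hReq := Finset.eq_of_subset_of_card_le hsub (by rw [Finset.card_pair hno]; omega)
    set A1 := A.filter (fun x : ℤ => (x : ZMod r) = ((0 : ℤ) : ZMod r)) with hA1
    set A2 := A.filter (fun x : ℤ => (x : ZMod r) = (o : ZMod r)) with hA2
    have hun : A1 ∪ A2 = A := by
      ext x
      simp only [hA1, hA2, Finset.mem_union, Finset.mem_filter]
      constructor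
      · tauto
      · intro hx
        have : (x : ZMod r) ∈ R := Finset.mem_image_of_mem _ hx
        rw [← hReq, Finset.mem_insert, Finset.mem_singleton] at this
        tauto
    have hdis : Disjoint A1 A2 := by
      rw [Finset.disjoint_left]
      intro x hx hx'
      exact hno ((Finset.mem_filter.1 hx).2.symm.trans (Finset.mem_filter.1 hx').2)
    have hcard : A.card = A1.card + A2.card := by
      rw [← Finset.card_union_of_disjoint hdis, hun]
    have n1 : A1.Nonempty := ⟨0, by simp [hA1, h0]⟩
    have n2 : A2.Nonempty := ⟨o, by simp [hA2, hoA]⟩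
    have hu : IsUnit ((o : ZMod r) - ((0 : ℤ) : ZMod r)) := by
      have := isUnit_odd m o hodd
      rw [hrr] at this
      simpa using this
    have e1 : ∀ y ∈ A1, (y : ZMod r) = ((0 : ℤ) : ZMod r) := fun y hy => (Finset.mem_filter.1 hy).2
    have e2 : ∀ y ∈ A2, (y : ZMod r) = (o : ZMod r) := fun y hy => (Finset.mem_filter.1 hy).2
    rcases le_total A2.card A1.card with hle | hle
    · have := main_two r hr A1 A2 n1 n2 hle _ _ e1 e2 hu
      rw [hun] at this
      rw [hcard]; exact this
    · have := main_two r hr A2 A1 n2 n1 hle _ _ e2 e1 (by rw [← neg_sub]; exact hu.neg)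
      rw [Finset.union_comm, hun] at this
      rw [hcard, add_comm A1.card]; exact this
  · rw [hk] at hb ⊢
    simp only [Nat.add_sub_cancel] at hb
    have : 3 * k ≤ R.card * k := Nat.mul_le_mul_right _ ht
    omega

lemma dilate_bound (m : ℕ) (hm : 2 ≤ m) (A : Finset ℤ) (hA : 2 ≤ A.card) :
    4 * A.card ≤ (A + A.image (fun x => ((2 ^ m : ℕ) : ℤ) * x)).card + 4 := by
  classical
  obtain ⟨a, ha, b, hb, hab⟩ := Finset.one_lt_card.1 hA
  have hex : ∃ e : ℕ, ¬ ∀ x ∈ A, (2 : ℤ) ^ (e + 1) ∣ x - a := by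
    by_contra hcon
    push Not at hcon
    have h1 : ∀ e : ℕ, (2 : ℤ) ^ (e + 1) ∣ b - a := fun e => hcon e b hb
    have hne : b - a ≠ 0 := sub_ne_zero.2 (Ne.symm hab)
    have h2 := Int.natAbs_dvd_natAbs.2 (h1 (b - a).natAbs)
    have h3 := Nat.le_of_dvd (Int.natAbs_pos.2 hne) h2
    rw [Int.natAbs_pow] at h3
    have h4 : (b - a).natAbs + 1 < 2 ^ ((b - a).natAbs + 1) := Nat.lt_two_pow_self
    rw [show (2 : ℤ).natAbs = 2 from rfl] at h3
    omega
  set e := Nat.find hex with he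
  have hspec : ¬ ∀ x ∈ A, (2 : ℤ) ^ (e + 1) ∣ x - a := Nat.find_spec hex
  have hdiv : ∀ x ∈ A, (2 : ℤ) ^ e ∣ x - a := by
    rcases Nat.eq_zero_or_pos e with h | h
    · intro x _; rw [h]; simp
    · have := Nat.find_min hex (m := e - 1) (by omega)
      rw [not_not, Nat.sub_add_cancel h] at this
      exact this
  set B := A.image (fun x => (x - a) / 2 ^ e) with hB
  have hinj : Function.Injective (fun w : ℤ => a + (2 : ℤ) ^ e * w) := by
    intro x y hxy
    simpa using hxy
  have hinj2 : Function.Injective (fun w : ℤ => a + ((2 ^ m : ℕ) : ℤ) * a + (2 : ℤ) ^ e * w) := by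
    intro x y hxy
    simpa using hxy
  have hq : ∀ y ∈ A, a + (2 : ℤ) ^ e * ((y - a) / 2 ^ e) = y := by
    intro y hy
    rw [Int.mul_ediv_cancel' (hdiv y hy)]
    ring
  have him : B.image (fun w : ℤ => a + (2 : ℤ) ^ e * w) = A := by
    rw [hB, Finset.image_image]
    ext z
    simp only [Finset.mem_image, Function.comp]
    constructor
    · rintro ⟨y, hy, rfl⟩; rw [hq y hy]; exact hy
    · intro hz; exact ⟨z, hz, hq z hz⟩
  have hc : A.card = B.card := by
    conv_lhs => rw [← him]
    rw [Finset.card_image_of_injective _ hinj]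
  have hs : A + A.image (fun x => ((2 ^ m : ℕ) : ℤ) * x) =
      (B + B.image (fun x => ((2 ^ m : ℕ) : ℤ) * x)).image
        (fun w : ℤ => a + ((2 ^ m : ℕ) : ℤ) * a + (2 : ℤ) ^ e * w) := by
    conv_lhs => rw [← him]
    ext z
    simp only [Finset.mem_image, Finset.mem_add]
    constructor
    · rintro ⟨_, ⟨x, hx, rfl⟩, _, ⟨_, ⟨y, hy, rfl⟩, rfl⟩, rfl⟩
      exact ⟨_, ⟨x, hx, _, ⟨y, hy, rfl⟩, rfl⟩, by ring⟩
    · rintro ⟨_, ⟨x, hx, _, ⟨y, hy, rfl⟩, rfl⟩, rfl⟩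
      exact ⟨_, ⟨x, hx, rfl⟩, _, ⟨_, ⟨y, hy, rfl⟩, rfl⟩, by ring⟩
  rw [hs, Finset.card_image_of_injective _ hinj2, hc]
  apply parity_bound m hm
  · exact Finset.mem_image.2 ⟨a, ha, by simp⟩
  · push Not at hspec
    obtain ⟨x, hx, hnd⟩ := hspec
    refine ⟨_, Finset.mem_image_of_mem _ hx, ?_⟩
    rw [← Int.not_even_iff_odd]
    rintro ⟨w, hw⟩
    apply hnd
    refine ⟨w, ?_⟩
    have := hq x hx
    rw [hw] at this
    rw [pow_succ]
    linear_combination -this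

/-! ### Group part -/

lemma bs_rel : bsa 2 * bsb 2 = bsb 2 * bsa 2 ^ (2 : ℤ) := by
  have h : (PresentedGroup.mk (BSRel 2)) (FreeGroup.of true * FreeGroup.of false *
      (FreeGroup.of false * FreeGroup.of true ^ (2 : ℤ))⁻¹) = 1 :=
    PresentedGroup.one_of_mem (rels := BSRel 2) rfl
  rw [map_mul, map_inv, mul_inv_eq_one, map_mul, map_mul, map_zpow] at h
  exact h

lemma bs_comm (x : ℤ) : bsa 2 ^ x * bsb 2 = bsb 2 * bsa 2 ^ (2 * x) := by
  have h : SemiconjBy (bsb 2) (bsa 2 ^ (2 : ℤ)) (bsa 2) := bs_rel.symm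
  have := h.zpow_right x
  rw [← zpow_mul] at this
  exact this.symm

lemma bs_comm_pow (m : ℕ) (x : ℤ) :
    bsa 2 ^ x * bsb 2 ^ m = bsb 2 ^ m * bsa 2 ^ (2 ^ m * x) := by
  induction m with
  | zero => simp
  | succ n ih =>
    rw [pow_succ, ← mul_assoc, ih, mul_assoc, bs_comm, ← mul_assoc]
    congr 2
    ring

noncomputable def bsGen : Bool → Equiv.Perm ℚ
  | true => Equiv.addRight 1
  | false => Equiv.mulLeft₀ (1 / 2) (by norm_num)

lemma bsGen_rel : ∀ w ∈ BSRel 2, FreeGroup.lift bsGen w = 1 := by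
  intro w hw
  rw [BSRel, Set.mem_singleton_iff] at hw
  subst hw
  rw [map_mul, map_inv, mul_inv_eq_one]
  ext x
  simp [bsGen]
  ring

lemma bsa_inj : Function.Injective (fun z : ℤ => bsa 2 ^ z) := by
  intro x y hxy
  have h := congrArg (fun g => (PresentedGroup.toGroup bsGen_rel g) (0 : ℚ)) hxy
  simpa [map_zpow, bsa, bsGen] using h

theorem stmt12 (m : ℕ) (hm : 2 ≤ m) (A : Finset ℤ) (hA : A.Nonempty) (k : ℕ)
    (hk : A.card = k) (S : Finset (BS 2))
    (hS : S = A.image (fun x => bsb 2 ^ m * bsa 2 ^ x)) :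
    S * S = (Finset.image₂ (fun x y => x + 2 ^ m * y) A A).image
        (fun z => bsb 2 ^ (2 * m) * bsa 2 ^ z) ∧
    ((S * S).card : ℤ) = (Finset.image₂ (fun x y => x + 2 ^ m * y) A A).card ∧
    max (4 * (k : ℤ) - 4) 1 ≤ ((S * S).card : ℤ) ∧
    3 * (k : ℤ) - 2 ≤ max (4 * (k : ℤ) - 4) 1 := by
  have hprod : ∀ x y : ℤ, (bsb 2 ^ m * bsa 2 ^ x) * (bsb 2 ^ m * bsa 2 ^ y) =
      bsb 2 ^ (2 * m) * bsa 2 ^ (y + 2 ^ m * x) := by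
    intro x y
    rw [mul_assoc, ← mul_assoc (bsa 2 ^ x), bs_comm_pow, two_mul, pow_add, mul_assoc, mul_assoc,
      ← zpow_add, add_comm]
  have h1 : S * S = (Finset.image₂ (fun x y => x + 2 ^ m * y) A A).image
        (fun z => bsb 2 ^ (2 * m) * bsa 2 ^ z) := by
    subst hS
    ext g
    simp only [Finset.mem_mul, Finset.mem_image, Finset.mem_image₂]
    constructor
    · rintro ⟨_, ⟨x, hx, rfl⟩, _, ⟨y, hy, rfl⟩, rfl⟩
      exact ⟨_, ⟨y, hy, x, hx, rfl⟩, (hprod x y).symm⟩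
    · rintro ⟨_, ⟨y, hy, x, hx, rfl⟩, rfl⟩
      exact ⟨_, ⟨x, hx, rfl⟩, _, ⟨y, hy, rfl⟩, hprod x y⟩
  have h2 : (S * S).card = (Finset.image₂ (fun x y => x + 2 ^ m * y) A A).card := by
    rw [h1]
    apply Finset.card_image_of_injective
    intro x y hxy
    exact bsa_inj (mul_left_cancel hxy)
  have hpos := hA.card_pos
  have h3 : Finset.image₂ (fun x y => x + 2 ^ m * y) A A =
      A + A.image (fun x => ((2 ^ m : ℕ) : ℤ) * x) := by
    ext z
    simp [Finset.mem_add]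
  refine ⟨h1, by rw [h2], ?_, ?_⟩
  · have hp : 0 < (S * S).card := by
      rw [h2]; exact (hA.image₂ hA).card_pos
    have : 4 * k ≤ (S * S).card + 4 := by
      rcases Nat.lt_or_ge A.card 2 with h | h
      · omega
      · have := dilate_bound m hm A h
        rw [h2, h3]; omega
    apply max_le <;> omega
  · rcases le_total (2 : ℤ) k with h | h
    · exact le_max_of_le_left (by omega)
    · rcases eq_or_lt_of_le h with h | h
      · exact le_max_of_le_left (by omega)
      · exact le_max_of_le_right (by omega)
end
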